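/- arXiv:2605.29760 — 13 statements merged into one kernel-verified Lean document; each statement's English description precedes it below -/
import Mathlib

section
/- Let X and Y be finite sets, let H0 and H1 be two classes of probability distributions on X, let W be a channel from X to Y, and let P0 and P1 be distinct probability mass functions on Y such that W∘μ = P_b for every μ ∈ H_b and b ∈ {0,1}. Then there exist a constant c > 0 and N ∈ ℕ such that for every n ≥ N there is a detector det : Y^n → {0,1} for which the scheme with W_i = W for every i = 1,…,n and detector det is an (e^{−c·n}, 0)-SDHT scheme (without shared key) for H0 vs. H1 using n samples. -/
/-- `P` is a probability mass function on the finite set `S`. -/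
def IsPMF {S : Type} [Fintype S] (P : S → ℝ) : Prop :=
  (∀ s, 0 ≤ P s) ∧ ∑ s, P s = 1

/-- The output distribution `W ∘ μ` of the channel `W` on input distribution `μ`. -/
noncomputable def pushChannel {X Y : Type} [Fintype X] (W : X → Y → ℝ) (μ : X → ℝ) : Y → ℝ :=
  fun y => ∑ x, μ x * W x y

/-- The product distribution `⊗ᵢ (Wᵢ ∘ μ)` of the messages received by the server when the
clients observe i.i.d. samples from `μ`. -/
noncomputable def schemeDist {X : Type} [Fintype X] {n : ℕ} {Y : Fin n → Type}
    (W : (i : Fin n) → X → Y i → ℝ) (μ : X → ℝ) : ((i : Fin n) → Y i) → ℝ :=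
  fun y => ∏ i, ∑ x, μ x * W i x (y i)

/-- Total variation distance between two pmfs on a finite set. -/
noncomputable def tvDist {S : Type} [Fintype S] (P Q : S → ℝ) : ℝ :=
  (∑ s, |P s - Q s|) / 2

/-- `(W, det)` is an `(ε, δ)`-SDHT scheme (without shared key) for `H 0` vs. `H 1`
using `n` samples: `(1-ε)`-correctness and `δ`-privacy. -/
def IsSDHT {X : Type} [Fintype X] {n : ℕ} {Y : Fin n → Type} [∀ i, Fintype (Y i)]
    (W : (i : Fin n) → X → Y i → ℝ) (det : ((i : Fin n) → Y i) → Fin 2)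
    (H : Fin 2 → Set (X → ℝ)) (ε δ : ℝ) : Prop :=
  (∀ b : Fin 2, ∀ μ ∈ H b,
      1 - ε ≤ ∑ y ∈ Finset.univ.filter (fun y => det y = b), schemeDist W μ y) ∧
  (∀ b : Fin 2, ∀ μ ∈ H b, ∀ μ' ∈ H b, tvDist (schemeDist W μ) (schemeDist W μ') ≤ δ)

/-- The Bhattacharyya coefficient of two distinct pmfs is less than one. -/
theorem bhattacharyya_lt_one {Y : Type} [Fintype Y] {P Q : Y → ℝ} (hP : IsPMF P) (hQ : IsPMF Q)
    (hne : P ≠ Q) : ∑ y, √(P y) * √(Q y) < 1 := by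
  obtain ⟨y₀, hy₀⟩ := Function.ne_iff.mp hne
  have key : ∀ y, (P y + Q y) / 2 - √(P y) * √(Q y) = (√(P y) - √(Q y)) ^ 2 / 2 := fun y => by
    have h₁ := Real.sq_sqrt (hP.1 y)
    have h₂ := Real.sq_sqrt (hQ.1 y)
    linear_combination -h₁ / 2 - h₂ / 2
  have hlt : ∑ y, √(P y) * √(Q y) < ∑ y, (P y + Q y) / 2 := by
    refine Finset.sum_lt_sum (fun y _ => ?_) ⟨y₀, Finset.mem_univ _, ?_⟩
    · nlinarith [key y, sq_nonneg (√(P y) - √(Q y))]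
    · have hs : √(P y₀) - √(Q y₀) ≠ 0 := fun h =>
        hy₀ ((Real.sqrt_inj (hP.1 y₀) (hQ.1 y₀)).mp (sub_eq_zero.mp h))
      have := key y₀
      have := sq_pos_of_ne_zero hs
      linarith
  rwa [← Finset.sum_div, Finset.sum_add_distrib, hP.2, hQ.2, show ((1 : ℝ) + 1) / 2 = 1 by norm_num]
    at hlt

theorem sum_prod_apply {Y : Type} [Fintype Y] (f : Y → ℝ) (n : ℕ) :
    ∑ y : Fin n → Y, ∏ i, f (y i) = (∑ y, f y) ^ n := by
  have := Finset.prod_univ_sum (fun _ : Fin n => (Finset.univ : Finset Y)) (fun _ => f)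
  simpa [Fintype.piFinset_univ] using this.symm

/-- The mass that a nonnegative weight `f` puts on a set where `f ≤ g` is bounded by the total
mass of the geometric mean of `f` and `g`. -/
theorem sum_filter_le_sum_sqrt {S : Type} [Fintype S] (p : S → Prop) [DecidablePred p]
    {f g : S → ℝ} (hf : ∀ s, 0 ≤ f s) (hfg : ∀ s, p s → f s ≤ g s) :
    ∑ s ∈ Finset.univ.filter p, f s ≤ ∑ s, √(f s) * √(g s) := by
  calc ∑ s ∈ Finset.univ.filter p, f s
      ≤ ∑ s ∈ Finset.univ.filter p, √(f s) * √(g s) := Finset.sum_le_sum fun s hs => by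
        have h := Real.sqrt_le_sqrt (hfg s (Finset.mem_filter.mp hs).2)
        nlinarith [Real.sq_sqrt (hf s), Real.sqrt_nonneg (f s)]
    _ ≤ ∑ s, √(f s) * √(g s) :=
        Finset.sum_le_sum_of_subset_of_nonneg (Finset.filter_subset _ _) fun _ _ _ => by positivity

theorem sum_sqrt_prod {Y : Type} [Fintype Y] {P Q : Y → ℝ} (hP : ∀ y, 0 ≤ P y) (hQ : ∀ y, 0 ≤ Q y)
    (n : ℕ) : ∑ y : Fin n → Y, √(∏ i, P (y i)) * √(∏ i, Q (y i)) =
      (∑ y, √(P y) * √(Q y)) ^ n := by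
  rw [← sum_prod_apply]
  refine Finset.sum_congr rfl fun y _ => ?_
  rw [Real.sqrt_prod _ fun i _ => hP _, Real.sqrt_prod _ fun i _ => hQ _,
    Finset.prod_mul_distrib]

/-- A detector that never decides against the likelier hypothesis errs with probability at most
the `n`-th power of the Bhattacharyya coefficient. -/
theorem one_sub_pow_le_sum_filter {Y : Type} [Fintype Y] {P Q : Y → ℝ} (hP : IsPMF P)
    (hQ : ∀ y, 0 ≤ Q y) {n : ℕ} (p : (Fin n → Y) → Prop) [DecidablePred p]
    (h : ∀ y, ¬ p y → ∏ i, P (y i) ≤ ∏ i, Q (y i)) :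
    1 - (∑ y, √(P y) * √(Q y)) ^ n ≤ ∑ y ∈ Finset.univ.filter p, ∏ i, P (y i) := by
  have htot := sum_prod_apply P n
  rw [hP.2, one_pow, ← Finset.sum_filter_add_sum_filter_not _ p] at htot
  have herr := sum_filter_le_sum_sqrt (fun y => ¬ p y)
    (fun y => Finset.prod_nonneg fun i _ => hP.1 (y i)) h
  rw [sum_sqrt_prod hP.1 hQ] at herr
  linarith

/-- if a single channel `W` maps every distribution of class `H b` to the same
distribution `P b`, with `P 0 ≠ P 1`, then there is an `(e^{-c n}, 0)`-SDHT scheme (without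
shared key) using `W` for every client, for all sufficiently large `n`. -/
theorem stmt0 {X Y : Type} [Fintype X] [Fintype Y]
    (H : Fin 2 → Set (X → ℝ)) (hH : ∀ b : Fin 2, ∀ μ ∈ H b, IsPMF μ)
    (W : X → Y → ℝ) (hW : ∀ x, IsPMF (W x))
    (P : Fin 2 → Y → ℝ) (hP : ∀ b, IsPMF (P b)) (hPne : P 0 ≠ P 1)
    (hmap : ∀ b : Fin 2, ∀ μ ∈ H b, pushChannel W μ = P b) :
    ∃ c > (0:ℝ), ∃ N : ℕ, ∀ n, N ≤ n → ∃ det : (Fin n → Y) → Fin 2,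
      IsSDHT (fun _ : Fin n => W) det H (Real.exp (-c * n)) 0 := by
  classical
  set ρ := ∑ y, √(P 0 y) * √(P 1 y)
  have hρ0 : 0 ≤ ρ := Finset.sum_nonneg fun y _ => by positivity
  have hρ1 : ρ < 1 := bhattacharyya_lt_one (hP 0) (hP 1) hPne
  set r := max ρ (1 / 2)
  have hr0 : 0 < r := lt_max_of_lt_right (by norm_num)
  have hr1 : r < 1 := max_lt hρ1 (by norm_num)
  refine ⟨-Real.log r, neg_pos.mpr (Real.log_neg hr0 hr1), 0, fun n _ => ?_⟩
  have hexp : Real.exp (- -Real.log r * n) = r ^ n := by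
    rw [neg_neg, mul_comm, Real.exp_nat_mul, Real.exp_log hr0]
  have hpow : ρ ^ n ≤ r ^ n := pow_le_pow_left₀ hρ0 (le_max_left _ _) n
  have hdist : ∀ b, ∀ μ ∈ H b,
      schemeDist (fun _ : Fin n => W) μ = fun y => ∏ i, P b (y i) := fun b μ hμ => by
    rw [← hmap b μ hμ]
    rfl
  refine ⟨fun y => if ∏ i, P 1 (y i) ≤ ∏ i, P 0 (y i) then 0 else 1, fun b μ hμ => ?_,
    fun b μ hμ μ' hμ' => ?_⟩
  · rw [hexp, hdist b μ hμ]
    refine (sub_le_sub_left hpow 1).trans ?_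
    fin_cases b
    · refine one_sub_pow_le_sum_filter (hP 0) (hP 1).1 _ fun y hy => ?_
      by_contra hlt
      exact hy (if_pos (not_le.mp hlt).le)
    · have hsymm : ρ = ∑ y, √(P 1 y) * √(P 0 y) :=
        Finset.sum_congr rfl fun y _ => mul_comm _ _
      rw [hsymm]
      refine one_sub_pow_le_sum_filter (hP 1) (hP 0).1 _ fun y hy => ?_
      by_contra hlt
      exact hy (if_neg hlt)
  · rw [hdist b μ hμ, hdist b μ' hμ']
    simp [tvDist]
end

section
/- For any pairwise distinct p0, p1, p2 ∈ [0,1], the hypotheses H0 = {Ber(p0), Ber(p1)} and H1 = {Ber(p2)} are not securely distinguishable without shared key: there exist ε > 0 and δ > 0 such that for every n ∈ ℕ, every choice of finite sets Y_1,…,Y_n, channels W_i from {0,1} to Y_i, and detector det : Y_1×⋯×Y_n → {0,1}, the resulting scheme is not simultaneously (1−ε)-correct and δ-private for H0 vs. H1 using n samples. -/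
/-- The Bernoulli distribution on `{0,1}` (as `Bool`) with `bern p true = p`. -/
noncomputable def bern (p : ℝ) : Bool → ℝ := fun b => if b then p else 1 - p

/-- `W` is a channel from `X` to the finite set `Y`: each row `W x` is a pmf on `Y`. -/
def IsChannel {X Y : Type} [Fintype Y] (W : X → Y → ℝ) : Prop :=
  ∀ x, (∀ y, 0 ≤ W x y) ∧ ∑ y, W x y = 1

open Finset

/-- The Bhattacharyya coefficient `∑ √(P Q)` of two nonnegative functions on a finite set. -/
noncomputable def bhattacharyya {S : Type} [Fintype S] (P Q : S → ℝ) : ℝ :=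
  ∑ s, √(P s) * √(Q s)

/-- The output distribution `W ∘ μ` of the channel `W` on the input distribution `μ`. -/
noncomputable def channelOutput {X Y : Type} [Fintype X] (W : X → Y → ℝ) (μ : X → ℝ) : Y → ℝ :=
  fun y => ∑ x, μ x * W x y

theorem channelOutput_bern {Y : Type} (W : Bool → Y → ℝ) (p : ℝ) (y : Y) :
    channelOutput W (bern p) y = p * W true y + (1 - p) * W false y := by
  simp [channelOutput, bern]

theorem channelOutput_bern_nonneg {Y : Type} [Fintype Y] {W : Bool → Y → ℝ} (hW : IsChannel W)
    {p : ℝ} (hp : p ∈ Set.Icc (0 : ℝ) 1) (y : Y) : 0 ≤ channelOutput W (bern p) y := by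
  rw [channelOutput_bern]
  exact add_nonneg (mul_nonneg hp.1 ((hW true).1 y))
    (mul_nonneg (sub_nonneg.2 hp.2) ((hW false).1 y))

theorem sum_channelOutput_bern {Y : Type} [Fintype Y] {W : Bool → Y → ℝ} (hW : IsChannel W)
    (p : ℝ) : ∑ y, channelOutput W (bern p) y = 1 := by
  simp only [channelOutput_bern, sum_add_distrib, ← mul_sum, (hW true).2, (hW false).2]
  ring

theorem schemeDist_eq_prod {X : Type} [Fintype X] {n : ℕ} {Y : Fin n → Type}
    (W : (i : Fin n) → X → Y i → ℝ) (μ : X → ℝ) (y : (i : Fin n) → Y i) :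
    schemeDist W μ y = ∏ i, channelOutput (W i) μ (y i) := rfl

section Product

variable {n : ℕ} {Y : Fin n → Type} [∀ i, Fintype (Y i)] {W : (i : Fin n) → Bool → Y i → ℝ}

theorem schemeDist_bern_nonneg (hW : ∀ i, IsChannel (W i)) {p : ℝ}
    (hp : p ∈ Set.Icc (0 : ℝ) 1) (y : (i : Fin n) → Y i) : 0 ≤ schemeDist W (bern p) y :=
  prod_nonneg fun i _ => channelOutput_bern_nonneg (hW i) hp (y i)

theorem sum_schemeDist_bern (hW : ∀ i, IsChannel (W i)) (p : ℝ) :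
    ∑ y, schemeDist W (bern p) y = 1 := by
  simp only [schemeDist_eq_prod]
  rw [← Fintype.piFinset_univ, ← prod_univ_sum]
  exact prod_eq_one fun i _ => sum_channelOutput_bern (hW i) p

theorem bhattacharyya_schemeDist_bern (hW : ∀ i, IsChannel (W i)) {p q : ℝ}
    (hp : p ∈ Set.Icc (0 : ℝ) 1) (hq : q ∈ Set.Icc (0 : ℝ) 1) :
    bhattacharyya (schemeDist W (bern p)) (schemeDist W (bern q)) =
      ∏ i, bhattacharyya (channelOutput (W i) (bern p)) (channelOutput (W i) (bern q)) := by
  simp only [bhattacharyya]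
  rw [prod_univ_sum, Fintype.piFinset_univ]
  refine sum_congr rfl fun y _ => ?_
  rw [schemeDist_eq_prod, schemeDist_eq_prod, prod_mul_distrib,
    Real.sqrt_prod _ fun i _ => channelOutput_bern_nonneg (hW i) hp (y i),
    Real.sqrt_prod _ fun i _ => channelOutput_bern_nonneg (hW i) hq (y i)]

end Product

section Bhattacharyya

variable {S : Type} [Fintype S] {P Q : S → ℝ}

theorem bhattacharyya_nonneg (P Q : S → ℝ) : 0 ≤ bhattacharyya P Q :=
  sum_nonneg fun _ _ => mul_nonneg (Real.sqrt_nonneg _) (Real.sqrt_nonneg _)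

theorem one_sub_tvDist_le_bhattacharyya (hP : ∀ s, 0 ≤ P s) (hQ : ∀ s, 0 ≤ Q s)
    (hP1 : ∑ s, P s = 1) (hQ1 : ∑ s, Q s = 1) : 1 - tvDist P Q ≤ bhattacharyya P Q := by
  have key : 1 - tvDist P Q = ∑ s, (P s + Q s - |P s - Q s|) / 2 := by
    rw [← sum_div, sum_sub_distrib, sum_add_distrib, hP1, hQ1, tvDist]
    ring
  rw [key]
  refine sum_le_sum fun s _ => ?_
  rcases le_total (P s) (Q s) with h | h
  · rw [abs_of_nonpos (sub_nonpos.2 h)]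
    have := mul_le_mul_of_nonneg_left (Real.sqrt_le_sqrt h) (Real.sqrt_nonneg (P s))
    linarith [Real.mul_self_sqrt (hP s)]
  · rw [abs_of_nonneg (sub_nonneg.2 h)]
    have := mul_le_mul_of_nonneg_right (Real.sqrt_le_sqrt h) (Real.sqrt_nonneg (Q s))
    linarith [Real.mul_self_sqrt (hQ s)]

theorem one_sub_bhattacharyya (hP : ∀ s, 0 ≤ P s) (hQ : ∀ s, 0 ≤ Q s)
    (hP1 : ∑ s, P s = 1) (hQ1 : ∑ s, Q s = 1) :
    1 - bhattacharyya P Q = (∑ s, (√(P s) - √(Q s)) ^ 2) / 2 := by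
  have h : ∀ s, (√(P s) - √(Q s)) ^ 2 = P s + Q s - 2 * (√(P s) * √(Q s)) := fun s => by
    rw [sub_sq, Real.sq_sqrt (hP s), Real.sq_sqrt (hQ s)]
    ring
  simp only [h, sum_sub_distrib, sum_add_distrib, ← mul_sum, hP1, hQ1, bhattacharyya]
  ring

theorem bhattacharyya_le_two_mul_sqrt {ε : ℝ} (det : S → Fin 2)
    (hP : ∀ s, 0 ≤ P s) (hQ : ∀ s, 0 ≤ Q s) (hP1 : ∑ s, P s = 1) (hQ1 : ∑ s, Q s = 1)
    (hP0 : 1 - ε ≤ ∑ s with det s = 0, P s) (hQ0 : 1 - ε ≤ ∑ s with det s = 1, Q s) :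
    bhattacharyya P Q ≤ 2 * √ε := by
  have hne : ∀ s, ¬ det s = 0 ↔ det s = 1 := fun s => by omega
  have hsplit : ∀ f : S → ℝ,
      ∑ s with det s = 0, f s + ∑ s with det s = 1, f s = ∑ s, f s := fun f => by
    simpa only [hne] using sum_filter_add_sum_filter_not univ (fun s => det s = 0) f
  have hnn : ∀ (f : S → ℝ) (b : Fin 2), (∀ s, 0 ≤ f s) → 0 ≤ ∑ s with det s = b, f s :=
    fun f b hf => sum_nonneg fun s _ => hf s
  have hP' := hsplit P
  have hQ' := hsplit Q
  have hcs : ∀ b : Fin 2, ∑ s with det s = b, √(P s) * √(Q s) ≤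
      √(∑ s with det s = b, P s) * √(∑ s with det s = b, Q s) := fun b =>
    Real.sum_sqrt_mul_sqrt_le _ hP hQ
  have hzero : √(∑ s with det s = 0, P s) * √(∑ s with det s = 0, Q s) ≤ 1 * √ε := by
    gcongr
    · exact Real.sqrt_le_one.2 (by linarith [hnn P 1 hP])
    · linarith
  have hone : √(∑ s with det s = 1, P s) * √(∑ s with det s = 1, Q s) ≤ √ε * 1 := by
    gcongr
    · linarith
    · exact Real.sqrt_le_one.2 (by linarith [hnn Q 0 hQ])
  rw [bhattacharyya, ← hsplit]
  linarith [hcs 0, hcs 1]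

end Bhattacharyya

theorem one_sub_sum_le_prod_one_sub_of_le_one {ι : Type*} (s : Finset ι) {g : ι → ℝ}
    (h0 : ∀ i ∈ s, 0 ≤ g i) (h1 : ∀ i ∈ s, g i ≤ 1) :
    1 - ∑ i ∈ s, g i ≤ ∏ i ∈ s, (1 - g i) := by
  classical
  induction s using Finset.induction_on with
  | empty => simp
  | insert i s hi ih =>
    simp only [forall_mem_insert] at h0 h1
    rw [sum_insert hi, prod_insert hi]
    have hmul := mul_le_mul_of_nonneg_left (ih h0.2 h1.2) (sub_nonneg.2 h1.1)
    nlinarith [mul_nonneg h0.1 (sum_nonneg h0.2)]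

/-- Squared differences of square roots of two points on a segment, measured between any two
pairs of parameters, are comparable. -/
theorem exists_sq_sqrt_sub_sqrt_le {p0 p1 p2 : ℝ} (h0 : p0 ∈ Set.Icc (0 : ℝ) 1)
    (h1 : p1 ∈ Set.Icc (0 : ℝ) 1) (h2 : p2 ∈ Set.Icc (0 : ℝ) 1) (h01 : p0 ≠ p1) (h02 : p0 ≠ p2) :
    ∃ C > (0 : ℝ), ∀ a b : ℝ, 0 ≤ a → 0 ≤ b →
      (√(p0 * a + (1 - p0) * b) - √(p2 * a + (1 - p2) * b)) ^ 2 ≤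
        C * (√(p0 * a + (1 - p0) * b) - √(p1 * a + (1 - p1) * b)) ^ 2 := by
  obtain ⟨h00, h01'⟩ := h0
  obtain ⟨h10, h11⟩ := h1
  obtain ⟨h20, h21⟩ := h2
  obtain ⟨m, hm, hm1, hm2⟩ : ∃ m > 0, m ≤ p0 + p2 ∧ m ≤ 2 - p0 - p2 := by
    refine ⟨min (p0 + p2) (2 - p0 - p2), lt_min ?_ ?_, min_le_left _ _, min_le_right _ _⟩
    · by_contra! h
      exact h02 (by linarith)
    · by_contra! h
      exact h02 (by linarith)
  have hd1 : 0 < (p0 - p1) ^ 2 := by have := sub_ne_zero.2 h01; positivity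
  have hd2 : 0 < (p0 - p2) ^ 2 := by have := sub_ne_zero.2 h02; positivity
  refine ⟨4 * (p0 - p2) ^ 2 / (m * (p0 - p1) ^ 2), by positivity, fun a b ha hb => ?_⟩
  have hx : 0 ≤ p0 * a + (1 - p0) * b :=
    add_nonneg (mul_nonneg h00 ha) (mul_nonneg (by linarith) hb)
  have hy : 0 ≤ p1 * a + (1 - p1) * b :=
    add_nonneg (mul_nonneg h10 ha) (mul_nonneg (by linarith) hb)
  have hz : 0 ≤ p2 * a + (1 - p2) * b :=
    add_nonneg (mul_nonneg h20 ha) (mul_nonneg (by linarith) hb)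
  have hxy : p0 * a + (1 - p0) * b + (p1 * a + (1 - p1) * b) ≤ 2 * (a + b) := by nlinarith
  have hxz : m * (a + b) ≤ p0 * a + (1 - p0) * b + (p2 * a + (1 - p2) * b) := by nlinarith
  have hlin : (p0 - p1) ^ 2 * (p0 * a + (1 - p0) * b - (p2 * a + (1 - p2) * b)) ^ 2 =
      (p0 - p2) ^ 2 * (p0 * a + (1 - p0) * b - (p1 * a + (1 - p1) * b)) ^ 2 := by ring
  have hsx := Real.sq_sqrt hx
  have hsy := Real.sq_sqrt hy
  have hsz := Real.sq_sqrt hz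
  have hnx := Real.sqrt_nonneg (p0 * a + (1 - p0) * b)
  have hny := Real.sqrt_nonneg (p1 * a + (1 - p1) * b)
  have hnz := Real.sqrt_nonneg (p2 * a + (1 - p2) * b)
  set u := √(p0 * a + (1 - p0) * b)
  set v := √(p1 * a + (1 - p1) * b)
  set w := √(p2 * a + (1 - p2) * b)
  rw [← hsx, ← hsy] at hxy
  rw [← hsx, ← hsz] at hxz
  rw [← hsx, ← hsy, ← hsz] at hlin
  rw [div_mul_eq_mul_div, le_div_iff₀ (by positivity)]
  rcases (add_nonneg ha hb).eq_or_lt with hab | hab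
  · have hu : u = 0 := by nlinarith
    have hw : w = 0 := by
      rw [← Real.sqrt_zero]
      have ha0 : a = 0 := by linarith
      have hb0 : b = 0 := by linarith
      simp [w, ha0, hb0]
    rw [hu, hw, sub_zero, zero_pow two_ne_zero, zero_mul]
    positivity
  · refine le_of_mul_le_mul_right ?_ hab
    have huw : m * (a + b) ≤ (u + w) ^ 2 := by nlinarith [mul_nonneg hnx hnz]
    have huv : (u + v) ^ 2 ≤ 4 * (a + b) := by nlinarith [sq_nonneg (u - v)]
    calc (u - w) ^ 2 * (m * (p0 - p1) ^ 2) * (a + b)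
        = (p0 - p1) ^ 2 * (u - w) ^ 2 * (m * (a + b)) := by ring
      _ ≤ (p0 - p1) ^ 2 * (u - w) ^ 2 * (u + w) ^ 2 := by gcongr
      _ = (p0 - p2) ^ 2 * (u - v) ^ 2 * (u + v) ^ 2 := by linear_combination hlin
      _ ≤ (p0 - p2) ^ 2 * (u - v) ^ 2 * (4 * (a + b)) := by gcongr
      _ = 4 * (p0 - p2) ^ 2 * (u - v) ^ 2 * (a + b) := by ring

/-- for pairwise distinct `p0, p1, p2 ∈ [0,1]`, the hypotheses
`{Ber(p0), Ber(p1)}` and `{Ber(p2)}` are not securely distinguishable without shared key. -/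
theorem stmt1 (p0 p1 p2 : ℝ) (h0 : p0 ∈ Set.Icc (0:ℝ) 1) (h1 : p1 ∈ Set.Icc (0:ℝ) 1)
    (h2 : p2 ∈ Set.Icc (0:ℝ) 1) (h01 : p0 ≠ p1) (h02 : p0 ≠ p2) (h12 : p1 ≠ p2) :
    ∃ ε > (0:ℝ), ∃ δ > (0:ℝ),
      ∀ (n : ℕ) (Y : Fin n → Type) [∀ i, Fintype (Y i)]
        (W : (i : Fin n) → Bool → Y i → ℝ) (det : ((i : Fin n) → Y i) → Fin 2),
        (∀ i, IsChannel (W i)) →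
        ¬ IsSDHT W det ![({bern p0, bern p1} : Set (Bool → ℝ)), {bern p2}] ε δ := by
  obtain ⟨C, hC, hcomp⟩ := exists_sq_sqrt_sub_sqrt_le h0 h1 h2 h01 h02
  refine ⟨1 / 25, by norm_num, 1 - Real.exp (-(1 / (2 * C))),
    sub_pos.2 (Real.exp_lt_one_iff.2 (neg_neg_of_pos (by positivity))), ?_⟩
  rintro n Y _ W det hW ⟨hcorrect, hprivate⟩
  have hupper : bhattacharyya (schemeDist W (bern p0)) (schemeDist W (bern p2)) ≤
      2 * √(1 / 25) :=
    bhattacharyya_le_two_mul_sqrt det (schemeDist_bern_nonneg hW h0)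
      (schemeDist_bern_nonneg hW h2) (sum_schemeDist_bern hW p0) (sum_schemeDist_bern hW p2)
      (hcorrect 0 _ (by simp)) (hcorrect 1 _ (by simp))
  have hsqrt : √(1 / 25 : ℝ) = 1 / 5 := by
    rw [Real.sqrt_eq_iff_mul_self_eq] <;> norm_num
  have hclose : Real.exp (-(1 / (2 * C))) ≤
      bhattacharyya (schemeDist W (bern p0)) (schemeDist W (bern p1)) := by
    have := one_sub_tvDist_le_bhattacharyya (schemeDist_bern_nonneg hW h0)
      (schemeDist_bern_nonneg hW h1) (sum_schemeDist_bern hW p0) (sum_schemeDist_bern hW p1)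
    linarith [hprivate 0 (bern p0) (by simp) (bern p1) (by simp)]
  rw [bhattacharyya_schemeDist_bern hW h0 h1] at hclose
  rw [bhattacharyya_schemeDist_bern hW h0 h2] at hupper
  have hhell : ∀ {p q : ℝ}, p ∈ Set.Icc (0 : ℝ) 1 → q ∈ Set.Icc (0 : ℝ) 1 → ∀ i,
      1 - bhattacharyya (channelOutput (W i) (bern p)) (channelOutput (W i) (bern q)) =
        (∑ y, (√(channelOutput (W i) (bern p) y) - √(channelOutput (W i) (bern q) y)) ^ 2) / 2 :=
    fun hp hq i => one_sub_bhattacharyya (channelOutput_bern_nonneg (hW i) hp)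
      (channelOutput_bern_nonneg (hW i) hq) (sum_channelOutput_bern (hW i) _)
      (sum_channelOutput_bern (hW i) _)
  set B : Fin n → ℝ := fun i =>
    bhattacharyya (channelOutput (W i) (bern p0)) (channelOutput (W i) (bern p1)) with hB
  set B' : Fin n → ℝ := fun i =>
    bhattacharyya (channelOutput (W i) (bern p0)) (channelOutput (W i) (bern p2)) with hB'
  have hle : ∀ i, 1 - B' i ≤ C * (1 - B i) := fun i => by
    simp only [hB, hB', hhell h0 h1 i, hhell h0 h2 i]
    rw [← mul_div_assoc, mul_sum]
    gcongr with y
    simp only [channelOutput_bern]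
    exact hcomp _ _ ((hW i true).1 y) ((hW i false).1 y)
  have hsum : ∑ i, (1 - B i) ≤ 1 / (2 * C) := by
    have hexp : ∏ i, B i ≤ Real.exp (-∑ i, (1 - B i)) := by
      rw [← sum_neg_distrib, Real.exp_sum]
      refine prod_le_prod (fun i _ => bhattacharyya_nonneg _ _) fun i _ => ?_
      linarith [Real.add_one_le_exp (-(1 - B i))]
    linarith [Real.exp_le_exp.1 (hclose.trans hexp)]
  have hlower : 1 - ∑ i, (1 - B' i) ≤ ∏ i, B' i := by
    have := one_sub_sum_le_prod_one_sub_of_le_one univ (g := fun i => 1 - B' i)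
      (fun i _ => by
        simp only [hB', hhell h0 h2 i]
        positivity)
      (fun i _ => sub_le_self 1 (bhattacharyya_nonneg _ _))
    simpa only [sub_sub_cancel] using this
  have hhalf : ∑ i, (1 - B' i) ≤ 1 / 2 :=
    calc ∑ i, (1 - B' i) ≤ ∑ i, C * (1 - B i) := sum_le_sum fun i _ => hle i
      _ = C * ∑ i, (1 - B i) := (mul_sum _ _ _).symm
      _ ≤ C * (1 / (2 * C)) := by gcongr
      _ = 1 / 2 := by field_simp
  rw [hsqrt] at hupper
  linarith
end

section
/- Let μ0, μ1, μ2 be probability distributions on the same finite set X with μ2 ≠ μ0 and μ2 ≠ μ1. Then there exist a constant c > 0 and N ∈ ℕ such that for every n ≥ N there is an (e^{−c·n}, 0)-SDHT scheme for {μ0, μ1} vs. {μ2} using n samples and a shared secret key uniform on 𝒦 = {0,1} (a 1-bit key). -/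
/-- `W` is a keyed channel from `X × K` to the finite set `Y`: each `W x k` is a pmf on `Y`. -/
def IsKeyedChannel {X K Y : Type} [Fintype Y] (W : X → K → Y → ℝ) : Prop :=
  ∀ x k, (∀ y, 0 ≤ W x k y) ∧ ∑ y, W x k y = 1

/-- Distribution of the messages `(Y₁, …, Yₙ)` when the clients observe i.i.d. samples from
`μ` and share a secret key uniform on `K`:
`P^μ(y) = (1/|K|) ∑ₖ ∏ᵢ ∑ₓ μ(x)·Wᵢ(yᵢ|x,k)`. -/
noncomputable def keyedDist {X K : Type} [Fintype X] [Fintype K] {n : ℕ} {Y : Fin n → Type}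
    (W : (i : Fin n) → X → K → Y i → ℝ) (μ : X → ℝ) : ((i : Fin n) → Y i) → ℝ :=
  fun y => (∑ k : K, ∏ i, ∑ x, μ x * W i x k (y i)) / (Fintype.card K)

/-- `(W, det)` is an `(ε, δ)`-SDHT scheme for `H 0` vs. `H 1` using `n` samples and a shared
secret key uniform on `K`: `(1-ε)`-correctness and `δ`-privacy. -/
def IsKeyedSDHT {X K : Type} [Fintype X] [Fintype K] {n : ℕ} {Y : Fin n → Type}
    [∀ i, Fintype (Y i)] (W : (i : Fin n) → X → K → Y i → ℝ)
    (det : ((i : Fin n) → Y i) → Fin 2) (H : Fin 2 → Set (X → ℝ)) (ε δ : ℝ) : Prop :=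
  (∀ b : Fin 2, ∀ μ ∈ H b,
      1 - ε ≤ ∑ y ∈ Finset.univ.filter (fun y => det y = b), keyedDist W μ y) ∧
  (∀ b : Fin 2, ∀ μ ∈ H b, ∀ μ' ∈ H b, tvDist (keyedDist W μ) (keyedDist W μ') ≤ δ)

/-- The pmf of `n` independent Bernoulli variables with success probability `p`. -/
noncomputable def bernoulliProd (n : ℕ) (p : ℝ) (y : Fin n → Bool) : ℝ :=
  ∏ i, bif y i then p else 1 - p

/-- The number of successes in `y`, as a real number. -/
noncomputable def successCount {n : ℕ} (y : Fin n → Bool) : ℝ :=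
  ∑ i, bif y i then 1 else 0

lemma bernoulliProd_nonneg {n : ℕ} {p : ℝ} (hp0 : 0 ≤ p) (hp1 : p ≤ 1) (y : Fin n → Bool) :
    0 ≤ bernoulliProd n p y :=
  Finset.prod_nonneg fun i _ => by cases y i <;> simp [hp0, hp1]

lemma sum_bernoulliProd (n : ℕ) (p : ℝ) : ∑ y, bernoulliProd n p y = 1 := by
  have h := Finset.prod_univ_sum (fun _ : Fin n => (Finset.univ : Finset Bool))
    (fun _ c => bif c then p else 1 - p)
  simp only [Fintype.piFinset_univ, Fintype.sum_bool, cond_true, cond_false] at h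
  unfold bernoulliProd
  rw [← h]
  simp

lemma bernoulli_mgf_le {p l : ℝ} (hp0 : 0 ≤ p) (hp1 : p ≤ 1) (hl : |l| ≤ 1) :
    p * Real.exp (l * (1 - p)) + (1 - p) * Real.exp (l * (0 - p)) ≤ Real.exp (l ^ 2) := by
  have bound : ∀ z : ℝ, |z| ≤ 1 → Real.exp (l * z) ≤ 1 + l * z + l ^ 2 := by
    intro z hz
    have hlz : |l * z| ≤ 1 := by
      rw [abs_mul]; exact mul_le_one₀ hl (abs_nonneg _) hz
    have h := (abs_le.mp (Real.abs_exp_sub_one_sub_id_le hlz)).2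
    have hz2 : z ^ 2 ≤ 1 := (sq_le_one_iff_abs_le_one z).mpr hz
    nlinarith [mul_le_mul_of_nonneg_left hz2 (sq_nonneg l)]
  have h1 := bound (1 - p) (abs_le.mpr ⟨by linarith, by linarith⟩)
  have h2 := bound (0 - p) (abs_le.mpr ⟨by linarith, by linarith⟩)
  have h3 := Real.add_one_le_exp (l ^ 2)
  nlinarith [mul_le_mul_of_nonneg_left h1 hp0,
    mul_le_mul_of_nonneg_left h2 (sub_nonneg.mpr hp1)]

lemma sum_bernoulliProd_mul_exp_le {n : ℕ} {p l : ℝ} (hp0 : 0 ≤ p) (hp1 : p ≤ 1)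
    (hl : |l| ≤ 1) :
    ∑ y, bernoulliProd n p y * Real.exp (l * (successCount y - n * p)) ≤
      Real.exp (n * l ^ 2) := by
  have key : ∀ y : Fin n → Bool,
      bernoulliProd n p y * Real.exp (l * (successCount y - n * p)) =
        ∏ i, (bif y i then p * Real.exp (l * (1 - p)) else (1 - p) * Real.exp (l * (0 - p))) := by
    intro y
    have hs : l * (successCount y - n * p) = ∑ i, l * ((bif y i then 1 else 0) - p) := by
      rw [← Finset.mul_sum, Finset.sum_sub_distrib]
      simp [successCount]
    rw [hs, Real.exp_sum, bernoulliProd, ← Finset.prod_mul_distrib]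
    exact Finset.prod_congr rfl fun i _ => by cases y i <;> simp
  have h := Finset.prod_univ_sum (fun _ : Fin n => (Finset.univ : Finset Bool))
    (fun _ c => bif c then p * Real.exp (l * (1 - p)) else (1 - p) * Real.exp (l * (0 - p)))
  simp only [Fintype.piFinset_univ, Fintype.sum_bool, cond_true, cond_false] at h
  rw [Finset.sum_congr rfl fun y _ => key y, ← h, Finset.prod_const, Finset.card_univ,
    Fintype.card_fin, Real.exp_nat_mul]
  have hp1' := sub_nonneg.mpr hp1
  exact pow_le_pow_left₀ (by positivity) (bernoulli_mgf_le hp0 hp1 hl) n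

/-- Chernoff bound: an event containing all `y` with success count within `n * r` of `n * p`
has probability at least `1 - 2 * exp (-n * r ^ 2 / 4)`. -/
lemma one_sub_le_sum_bernoulliProd {n : ℕ} {p r : ℝ} (hp0 : 0 ≤ p) (hp1 : p ≤ 1)
    (hr0 : 0 ≤ r) (hr1 : r ≤ 1) (A : Finset (Fin n → Bool))
    (hA : ∀ y, |successCount y - n * p| < n * r → y ∈ A) :
    1 - 2 * Real.exp (-(n * r ^ 2 / 4)) ≤ ∑ y ∈ A, bernoulliProd n p y := by
  classical
  have hsplit := Finset.sum_add_sum_compl A (bernoulliProd n p)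
  rw [sum_bernoulliProd] at hsplit
  have hl : |r / 2| ≤ 1 := abs_le.mpr ⟨by linarith, by linarith⟩
  have hl' : |-(r / 2)| ≤ 1 := by rwa [abs_neg]
  have hpos := sum_bernoulliProd_mul_exp_le (n := n) hp0 hp1 hl
  have hneg := sum_bernoulliProd_mul_exp_le (n := n) hp0 hp1 hl'
  set E := Real.exp (-(n * r ^ 2 / 2)) with hE
  have hpt : ∀ y : Fin n → Bool, y ∈ Aᶜ → bernoulliProd n p y ≤
      E * (bernoulliProd n p y * Real.exp (r / 2 * (successCount y - n * p)) +
        bernoulliProd n p y * Real.exp (-(r / 2) * (successCount y - n * p))) := by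
    intro y hy
    have hfar : n * r ≤ |successCount y - n * p| := by
      by_contra! h
      exact Finset.mem_compl.mp hy (hA y h)
    have hone : 1 ≤ E * (Real.exp (r / 2 * (successCount y - n * p)) +
        Real.exp (-(r / 2) * (successCount y - n * p))) := by
      rw [mul_add, hE, ← Real.exp_add, ← Real.exp_add]
      rcases le_abs.mp hfar with h | h
      · have : 1 ≤ Real.exp (-(n * r ^ 2 / 2) + r / 2 * (successCount y - n * p)) :=
          Real.one_le_exp (by nlinarith [mul_le_mul_of_nonneg_left h hr0])
        linarith [Real.exp_pos (-(n * r ^ 2 / 2) + -(r / 2) * (successCount y - n * p))]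
      · have : 1 ≤ Real.exp (-(n * r ^ 2 / 2) + -(r / 2) * (successCount y - n * p)) :=
          Real.one_le_exp (by nlinarith [mul_le_mul_of_nonneg_left h hr0])
        linarith [Real.exp_pos (-(n * r ^ 2 / 2) + r / 2 * (successCount y - n * p))]
    nlinarith [mul_le_mul_of_nonneg_left hone (bernoulliProd_nonneg hp0 hp1 y)]
  have htail : ∑ y ∈ Aᶜ, bernoulliProd n p y ≤ 2 * Real.exp (-(n * r ^ 2 / 4)) := by
    calc _ ≤ ∑ y ∈ Aᶜ, E * (bernoulliProd n p y * Real.exp (r / 2 * (successCount y - n * p)) +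
          bernoulliProd n p y * Real.exp (-(r / 2) * (successCount y - n * p))) :=
          Finset.sum_le_sum hpt
      _ ≤ ∑ y, E * (bernoulliProd n p y * Real.exp (r / 2 * (successCount y - n * p)) +
          bernoulliProd n p y * Real.exp (-(r / 2) * (successCount y - n * p))) :=
          Finset.sum_le_sum_of_subset_of_nonneg (Finset.subset_univ _) fun y _ _ => by
            have := bernoulliProd_nonneg hp0 hp1 y
            positivity
      _ ≤ E * (Real.exp (n * (r / 2) ^ 2) + Real.exp (n * (-(r / 2)) ^ 2)) := by
          rw [← Finset.mul_sum, Finset.sum_add_distrib]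
          gcongr
      _ = 2 * Real.exp (-(n * r ^ 2 / 4)) := by
          rw [neg_sq, ← two_mul, mul_left_comm, hE, ← Real.exp_add]
          ring_nf
  linarith

lemma IsPMF.le_one {S : Type} [Fintype S] {P : S → ℝ} (hP : IsPMF P) (s : S) : P s ≤ 1 :=
  hP.2 ▸ Finset.single_le_sum (fun t _ => hP.1 t) (Finset.mem_univ s)

lemma IsPMF.sum_mul_mem_Icc {S : Type} [Fintype S] {P f : S → ℝ} (hP : IsPMF P) {a b : ℝ}
    (hf : ∀ s, f s ∈ Set.Icc a b) : ∑ s, P s * f s ∈ Set.Icc a b := by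
  constructor
  · calc a = ∑ s, P s * a := by rw [← Finset.sum_mul, hP.2, one_mul]
      _ ≤ _ := Finset.sum_le_sum fun s _ => mul_le_mul_of_nonneg_left (hf s).1 (hP.1 s)
  · calc _ ≤ ∑ s, P s * b :=
          Finset.sum_le_sum fun s _ => mul_le_mul_of_nonneg_left (hf s).2 (hP.1 s)
      _ = b := by rw [← Finset.sum_mul, hP.2, one_mul]

/-- A function whose expectation separates a pmf from two others. -/
lemma exists_separating {X : Type} [Fintype X] {μ0 μ1 μ2 : X → ℝ}
    (h0 : IsPMF μ0) (h1 : IsPMF μ1) (h2 : IsPMF μ2) (h20 : μ2 ≠ μ0) (h21 : μ2 ≠ μ1) :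
    ∃ f : X → ℝ, (∀ x, f x ∈ Set.Icc (3 / 8 : ℝ) (5 / 8)) ∧
      ∑ x, μ2 x * f x ≠ ∑ x, μ0 x * f x ∧ ∑ x, μ2 x * f x ≠ ∑ x, μ1 x * f x := by
  have hsq : ∀ μ : X → ℝ, μ2 ≠ μ → ∑ x, (μ2 x - μ x) * (μ2 x - μ x) ≠ 0 := by
    intro μ hμ h
    apply hμ
    funext x
    have := (Finset.sum_eq_zero_iff_of_nonneg fun x _ => mul_self_nonneg (μ2 x - μ x)).mp h x
      (Finset.mem_univ x)
    exact sub_eq_zero.mp (mul_self_eq_zero.mp this)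
  have hdir : ∃ h : X → ℝ, (∀ x, |h x| ≤ 2) ∧
      ∑ x, (μ2 x - μ0 x) * h x ≠ 0 ∧ ∑ x, (μ2 x - μ1 x) * h x ≠ 0 := by
    by_cases horth : ∑ x, (μ2 x - μ1 x) * (μ2 x - μ0 x) = 0
    · refine ⟨fun x => (μ2 x - μ0 x) + (μ2 x - μ1 x), fun x => ?_, ?_, ?_⟩
      · have := h0.1 x; have := h1.1 x; have := h2.1 x
        have := h0.le_one x; have := h1.le_one x; have := h2.le_one x
        exact abs_le.mpr ⟨by linarith, by linarith⟩
      · have : ∑ x, (μ2 x - μ0 x) * (μ2 x - μ1 x) = 0 := by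
          rw [← horth]; exact Finset.sum_congr rfl fun x _ => mul_comm _ _
        simp only [mul_add, Finset.sum_add_distrib]
        rw [this, add_zero]
        exact hsq μ0 h20
      · simp only [mul_add, Finset.sum_add_distrib]
        rw [horth, zero_add]
        exact hsq μ1 h21
    · refine ⟨fun x => μ2 x - μ0 x, fun x => ?_, hsq μ0 h20, horth⟩
      have := h0.1 x; have := h2.1 x; have := h0.le_one x; have := h2.le_one x
      exact abs_le.mpr ⟨by linarith, by linarith⟩
  obtain ⟨h, hb, hu, hv⟩ := hdir
  have hexp : ∀ μ : X → ℝ, IsPMF μ → ∑ x, μ x * (1 / 2 + h x / 16) =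
      1 / 2 + (∑ x, μ x * h x) / 16 := by
    intro μ hμ
    simp only [mul_add, Finset.sum_add_distrib, ← Finset.sum_mul, hμ.2, one_mul,
      Finset.sum_div, mul_div_assoc]
  simp only [sub_mul, Finset.sum_sub_distrib] at hu hv
  refine ⟨fun x => 1 / 2 + h x / 16, fun x => ?_, ?_, ?_⟩
  · have := abs_le.mp (hb x)
    exact ⟨by linarith, by linarith⟩
  · rw [hexp _ h0, hexp _ h2]
    intro h; exact hu (by linarith)
  · rw [hexp _ h1, hexp _ h2]
    intro h; exact hv (by linarith)

/-- The channel sending a random bit with mean `f x` or `g x`, depending on the key. -/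
noncomputable def bitChannel {X : Type} (f g : X → ℝ) (x : X) (k y : Bool) : ℝ :=
  bif y then (bif k then f x else g x) else 1 - (bif k then f x else g x)

lemma isKeyedChannel_bitChannel {X : Type} {f g : X → ℝ} (hf : ∀ x, f x ∈ Set.Icc (0 : ℝ) 1)
    (hg : ∀ x, g x ∈ Set.Icc (0 : ℝ) 1) : IsKeyedChannel (bitChannel f g) := by
  intro x k
  have := hf x
  have := hg x
  refine ⟨fun y => ?_, by simp [bitChannel]⟩
  cases k <;> cases y <;> simp_all [bitChannel]

lemma keyedDist_bitChannel {X : Type} [Fintype X] {n : ℕ} (f g : X → ℝ) {μ : X → ℝ}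
    (hμ : IsPMF μ) (y : Fin n → Bool) :
    keyedDist (fun _ : Fin n => bitChannel f g) μ y =
      (bernoulliProd n (∑ x, μ x * f x) y + bernoulliProd n (∑ x, μ x * g x) y) / 2 := by
  have hbit : ∀ (k c : Bool), ∑ x, μ x * bitChannel f g x k c =
      bif c then (∑ x, μ x * (bif k then f x else g x))
        else 1 - ∑ x, μ x * (bif k then f x else g x) := by
    intro k c
    cases c <;> simp [bitChannel, mul_sub, Finset.sum_sub_distrib, hμ.2]
  simp [keyedDist, hbit, bernoulliProd]

/-- for probability distributions `μ0, μ1, μ2` on a finite set `X` with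
`μ2 ≠ μ0` and `μ2 ≠ μ1`, there are `c > 0` and `N` such that for every `n ≥ N` there is an
`(e^{-c n}, 0)`-SDHT scheme for `{μ0, μ1}` vs. `{μ2}` using `n` samples and a 1-bit shared
secret key (uniform on `Bool`). -/
theorem stmt3 {X : Type} [Fintype X] (μ0 μ1 μ2 : X → ℝ)
    (h0 : IsPMF μ0) (h1 : IsPMF μ1) (h2 : IsPMF μ2) (h20 : μ2 ≠ μ0) (h21 : μ2 ≠ μ1) :
    ∃ c > (0:ℝ), ∃ N : ℕ, ∀ n, N ≤ n →
      ∃ (Y : Fin n → Type) (inst : ∀ i, Fintype (Y i))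
        (W : (i : Fin n) → X → Bool → Y i → ℝ) (det : ((i : Fin n) → Y i) → Fin 2),
        (∀ i, @IsKeyedChannel X Bool (Y i) (inst i) (W i)) ∧
        @IsKeyedSDHT X Bool _ _ n Y inst W det ![({μ0, μ1} : Set (X → ℝ)), {μ2}]
          (Real.exp (-c * n)) 0 := by
  classical
  obtain ⟨f, hf, hne0, hne1⟩ := exists_separating h0 h1 h2 h20 h21
  set a := ∑ x, μ0 x * f x with ha
  set b := ∑ x, μ1 x * f x with hb
  set t := ∑ x, μ2 x * f x
  have haI : a ∈ Set.Icc (3 / 8 : ℝ) (5 / 8) := h0.sum_mul_mem_Icc hf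
  have hbI : b ∈ Set.Icc (3 / 8 : ℝ) (5 / 8) := h1.sum_mul_mem_Icc hf
  have htI : t ∈ Set.Icc (3 / 8 : ℝ) (5 / 8) := h2.sum_mul_mem_Icc hf
  obtain ⟨ha0, ha1⟩ := haI
  obtain ⟨hb0, hb1⟩ := hbI
  obtain ⟨ht0, ht1⟩ := htI
  set g : X → ℝ := fun x => a + b - f x with hg
  have hgsum : ∀ μ : X → ℝ, IsPMF μ → ∑ x, μ x * g x = a + b - ∑ x, μ x * f x := by
    intro μ hμ
    simp only [hg, mul_sub, Finset.sum_sub_distrib, ← Finset.sum_mul, hμ.2, one_mul]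
  obtain ⟨r, hr0, hr1, hra, hrb⟩ : ∃ r : ℝ, 0 < r ∧ r ≤ 1 ∧ 2 * r ≤ |t - a| ∧ 2 * r ≤ |t - b| := by
    have hta : 0 < |t - a| := abs_pos.mpr (sub_ne_zero.mpr hne0)
    have htb : 0 < |t - b| := abs_pos.mpr (sub_ne_zero.mpr hne1)
    have hlt : |t - a| ≤ 1 := abs_le.mpr ⟨by linarith, by linarith⟩
    refine ⟨min |t - a| |t - b| / 2, half_pos (lt_min hta htb), ?_, ?_, ?_⟩
    · linarith [min_le_left |t - a| |t - b|]
    · linarith [min_le_left |t - a| |t - b|]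
    · linarith [min_le_right |t - a| |t - b|]
  refine ⟨r ^ 2 / 8, by positivity, ⌈8 / r ^ 2⌉₊, fun n hn => ?_⟩
  have hn8 : 1 ≤ n * r ^ 2 / 8 := by
    have := (div_le_iff₀ (by positivity)).mp (Nat.ceil_le.mp hn)
    linarith
  have hexp : 2 * Real.exp (-(n * r ^ 2 / 4)) ≤ Real.exp (-(r ^ 2 / 8) * n) := by
    have h2e : 2 ≤ Real.exp (n * r ^ 2 / 8) := by
      linarith [Real.add_one_le_exp (n * r ^ 2 / 8)]
    calc _ ≤ Real.exp (n * r ^ 2 / 8) * Real.exp (-(n * r ^ 2 / 4)) := by gcongr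
      _ = _ := by rw [← Real.exp_add]; ring_nf
  let det : (Fin n → Bool) → Fin 2 := fun y =>
    if |successCount y - n * a| < n * r ∨ |successCount y - n * b| < n * r then 0 else 1
  have hcorrect : ∀ (c : Fin 2) (p q : ℝ), p ∈ Set.Icc (0 : ℝ) 1 → q ∈ Set.Icc (0 : ℝ) 1 →
      (∀ y, |successCount y - n * p| < n * r → det y = c) →
      (∀ y, |successCount y - n * q| < n * r → det y = c) →
      1 - Real.exp (-(r ^ 2 / 8) * n) ≤ ∑ y ∈ Finset.univ.filter (fun y => det y = c),
        (bernoulliProd n p y + bernoulliProd n q y) / 2 := by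
    intro c p q hp hq hpd hqd
    have h1 := one_sub_le_sum_bernoulliProd hp.1 hp.2 hr0.le hr1
      (Finset.univ.filter (fun y => det y = c)) (by simpa using hpd)
    have h2 := one_sub_le_sum_bernoulliProd hq.1 hq.2 hr0.le hr1
      (Finset.univ.filter (fun y => det y = c)) (by simpa using hqd)
    rw [← Finset.sum_div, Finset.sum_add_distrib]
    linarith
  have hdet_a : ∀ y, |successCount y - n * a| < n * r → det y = 0 := fun y hy => if_pos (.inl hy)
  have hdet_b : ∀ y, |successCount y - n * b| < n * r → det y = 0 := fun y hy => if_pos (.inr hy)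
  have hfar : ∀ s u v : ℝ, 2 * r ≤ |u - v| → |s - n * u| < n * r → ¬ |s - n * v| < n * r := by
    intro s u v huv hu hv
    have hle := abs_sub_le (n * u) s (n * v)
    rw [← mul_sub, abs_mul, Nat.abs_cast, abs_sub_comm _ s] at hle
    nlinarith [mul_le_mul_of_nonneg_left huv (Nat.cast_nonneg (α := ℝ) n)]
  have hdet_far : ∀ u : ℝ, 2 * r ≤ |u - a| → 2 * r ≤ |u - b| →
      ∀ y, |successCount y - n * u| < n * r → det y = 1 := fun u hua hub y hy =>
    if_neg (not_or.mpr ⟨hfar _ _ _ hua hy, hfar _ _ _ hub hy⟩)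
  have hdist0 : keyedDist (fun _ : Fin n => bitChannel f g) μ0 =
      fun y => (bernoulliProd n a y + bernoulliProd n b y) / 2 := by
    funext y
    rw [keyedDist_bitChannel f g h0, hgsum _ h0, ← ha, add_sub_cancel_left]
  have hdist1 : keyedDist (fun _ : Fin n => bitChannel f g) μ1 =
      fun y => (bernoulliProd n a y + bernoulliProd n b y) / 2 := by
    funext y
    rw [keyedDist_bitChannel f g h1, hgsum _ h1, ← hb, add_sub_cancel_right, add_comm]
  have hdist2 : keyedDist (fun _ : Fin n => bitChannel f g) μ2 =
      fun y => (bernoulliProd n t y + bernoulliProd n (a + b - t) y) / 2 := by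
    funext y
    rw [keyedDist_bitChannel f g h2, hgsum _ h2]
  have hcorrect0 := hcorrect 0 a b ⟨by linarith, by linarith⟩ ⟨by linarith, by linarith⟩
    hdet_a hdet_b
  have hcorrect1 := hcorrect 1 t (a + b - t) ⟨by linarith, by linarith⟩
    ⟨by linarith, by linarith⟩ (hdet_far t hra hrb)
    (hdet_far _ (by rwa [show a + b - t - a = -(t - b) by ring, abs_neg])
      (by rwa [show a + b - t - b = -(t - a) by ring, abs_neg]))
  refine ⟨fun _ => Bool, fun _ => inferInstance, fun _ => bitChannel f g, det,
    fun _ => isKeyedChannel_bitChannel (f := f) (g := g)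
      (fun x => ⟨by linarith [(hf x).1], by linarith [(hf x).2]⟩)
      (fun x => ⟨by simp only [hg]; linarith [(hf x).2], by simp only [hg]; linarith [(hf x).1]⟩),
    ?_, ?_⟩
  · intro c μ hμ
    fin_cases c
    · rcases hμ with rfl | rfl
      · rw [hdist0]; exact hcorrect0
      · rw [hdist1]; exact hcorrect0
    · obtain rfl := hμ
      rw [hdist2]; exact hcorrect1
  · intro c μ hμ μ' hμ'
    have heq : keyedDist (fun _ : Fin n => bitChannel f g) μ =
        keyedDist (fun _ : Fin n => bitChannel f g) μ' := by
      fin_cases c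
      · rcases hμ with rfl | rfl <;> rcases hμ' with rfl | rfl <;> simp only [hdist0, hdist1]
      · obtain rfl := hμ
        obtain rfl := hμ'
        rfl
    rw [heq]
    simp [tvDist]
end

section
/- Fix θ ∈ (0,1). There exists a finite constant M (depending only on θ) such that for all q0, q1 ∈ [0,1] with q1 < q0, setting q' = q1 + (1−θ)(q0 − q1), one has H²(Ber(q'), Ber(q1)) ≤ M · H²(Ber(q0), Ber(q')). Equivalently, the supremum over binary-output channels W from {0,1} to {0,1} with W(·|0) ≠ W(·|1) of the ratio H²(W∘Ber(θ), W∘Ber(1)) / H²(W∘Ber(0), W∘Ber(θ)) is finite. -/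
/-- Squared Hellinger distance between two pmfs on a finite set. -/
noncomputable def hellingerSq {S : Type} [Fintype S] (P Q : S → ℝ) : ℝ :=
  ∑ s, (Real.sqrt (P s) - Real.sqrt (Q s)) ^ 2

/-- If `m = (1 - θ) x + θ z`, then `√m` is at most a constant times farther from `√z` than from
`√x`. -/
lemma abs_sqrt_convexComb_sub_le {θ x z : ℝ} (hθ : θ ∈ Set.Ioo (0:ℝ) 1) (hx : 0 ≤ x)
    (hz : 0 ≤ z) :
    |√((1 - θ) * x + θ * z) - √z| ≤
      (1 - θ) / θ * (1 + 1 / √(1 - θ)) * |√x - √((1 - θ) * x + θ * z)| := by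
  obtain ⟨h0, h1⟩ := hθ
  have h1' : 0 < 1 - θ := by linarith
  have hk : 0 < √(1 - θ) := Real.sqrt_pos.2 h1'
  set m := (1 - θ) * x + θ * z with hm
  have hm0 : 0 ≤ m := by positivity
  have hkx : √(1 - θ) * √x ≤ √m := by
    rw [← Real.sqrt_mul h1'.le]
    exact Real.sqrt_le_sqrt (by rw [hm]; nlinarith [mul_nonneg h0.le hz])
  have hxm : √x ≤ 1 / √(1 - θ) * √m := by
    rw [one_div, inv_mul_eq_div, le_div_iff₀ hk]
    linarith
  have hu := Real.sqrt_nonneg m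
  have ht := Real.sqrt_nonneg z
  have hs := Real.sqrt_nonneg x
  rcases (add_nonneg hu ht).eq_or_lt with h | h
  · rw [show √m = √z by linarith, sub_self, abs_zero]
    positivity
  refine le_of_mul_le_mul_right ?_ h
  have heq : (√m - √z) * (√m + √z) = (1 - θ) / θ * ((√x - √m) * (√x + √m)) := by
    rw [div_mul_eq_mul_div, eq_div_iff h0.ne']
    linear_combination θ * Real.sq_sqrt hm0 - θ * Real.sq_sqrt hz
      - (1 - θ) * Real.sq_sqrt hx + (1 - θ) * Real.sq_sqrt hm0 + hm
  calc |√m - √z| * (√m + √z)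
      = |(√m - √z) * (√m + √z)| := by rw [abs_mul, abs_of_pos h]
    _ = (1 - θ) / θ * (|√x - √m| * (√x + √m)) := by
        rw [heq, abs_mul, abs_mul, abs_of_pos (div_pos h1' h0), abs_of_nonneg (add_nonneg hs hu)]
    _ ≤ (1 - θ) / θ * (|√x - √m| * ((1 + 1 / √(1 - θ)) * (√m + √z))) := by
        have : 0 ≤ 1 / √(1 - θ) * √z := by positivity
        gcongr
        linarith
    _ = _ := by ring

/-- The Hellinger comparison for a mixture `R = (1 - θ) P + θ Q` on any finite set. -/
lemma hellingerSq_convexComb_le {S : Type} [Fintype S] {θ : ℝ} (hθ : θ ∈ Set.Ioo (0:ℝ) 1)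
    {P Q R : S → ℝ} (hP : ∀ s, 0 ≤ P s) (hQ : ∀ s, 0 ≤ Q s)
    (hR : ∀ s, R s = (1 - θ) * P s + θ * Q s) :
    hellingerSq R Q ≤ ((1 - θ) / θ * (1 + 1 / √(1 - θ))) ^ 2 * hellingerSq P R := by
  unfold hellingerSq
  rw [Finset.mul_sum]
  refine Finset.sum_le_sum fun s _ => ?_
  rw [hR, ← sq_abs, ← sq_abs (√(P s) - _), ← mul_pow]
  exact pow_le_pow_left₀ (abs_nonneg _) (abs_sqrt_convexComb_sub_le hθ (hP s) (hQ s)) 2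

lemma bern_nonneg {p : ℝ} (hp : p ∈ Set.Icc (0:ℝ) 1) (b : Bool) : 0 ≤ bern p b := by
  cases b <;> simp [bern, hp.1, hp.2]

lemma pushChannel_bern {Y : Type} (W : Bool → Y → ℝ) (p : ℝ) (y : Y) :
    pushChannel W (bern p) y = (1 - p) * W false y + p * W true y := by
  simp [pushChannel, bern, add_comm]

/-- for fixed `θ ∈ (0,1)` there is a finite constant `M` such that for all
`q0, q1 ∈ [0,1]` with `q1 < q0`, setting `q' = q1 + (1−θ)(q0−q1)`, one has
`H²(Ber(q'), Ber(q1)) ≤ M·H²(Ber(q0), Ber(q'))`; equivalently, the Hellinger ratio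
`H²(W∘Ber(θ), W∘Ber(1)) / H²(W∘Ber(0), W∘Ber(θ))` is uniformly bounded over binary-output
channels `W` with distinct rows. -/
theorem stmt5 (θ : ℝ) (hθ : θ ∈ Set.Ioo (0:ℝ) 1) :
    ∃ M : ℝ,
      (∀ q0 q1 : ℝ, q0 ∈ Set.Icc (0:ℝ) 1 → q1 ∈ Set.Icc (0:ℝ) 1 → q1 < q0 →
        hellingerSq (bern (q1 + (1 - θ) * (q0 - q1))) (bern q1) ≤
          M * hellingerSq (bern q0) (bern (q1 + (1 - θ) * (q0 - q1)))) ∧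
      (∀ W : Bool → Bool → ℝ, IsChannel W → W false ≠ W true →
        hellingerSq (pushChannel W (bern θ)) (pushChannel W (bern 1)) ≤
          M * hellingerSq (pushChannel W (bern 0)) (pushChannel W (bern θ))) := by
  refine ⟨((1 - θ) / θ * (1 + 1 / √(1 - θ))) ^ 2, fun q0 q1 h0 h1 _ => ?_, fun W hW _ => ?_⟩
  · refine hellingerSq_convexComb_le hθ (bern_nonneg h0) (bern_nonneg h1) fun s => ?_
    cases s <;> simp only [bern, if_true, Bool.false_eq_true, if_false] <;> ring
  · refine hellingerSq_convexComb_le hθ (fun s => ?_) (fun s => ?_) fun s => ?_ <;>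
      simp only [pushChannel_bern, sub_zero, sub_self, zero_mul, one_mul, add_zero, zero_add]
    · exact (hW false).1 s
    · exact (hW true).1 s
end

section
/- Let X be a finite set, let H0 and H1 be two classes of probability distributions on X, let ε ≥ 0, and let det : X^n → {0,1} be a (1−ε)-correct hypothesis test for H0 vs. H1 using n samples. Let ({W_i}_{i=1}^n, φ) be a PSM protocol for det with key set 𝒦. Then the scheme consisting of the channels W_i and detector φ is an (ε, ε)-SDHT scheme for H0 vs. H1 using n samples and a shared secret key uniform on 𝒦; that is, it is (1−ε)-correct and for each b ∈ {0,1} and all μ, μ′ ∈ H_b, d_TV(P^μ_{Y^n}, P^{μ′}_{Y^n}) ≤ ε. -/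
/-- Distribution of the messages when the inputs are `x` and the key is uniform on `K`. -/
noncomputable def messageDist {X K : Type} [Fintype K] {n : ℕ} {Y : Fin n → Type}
    (W : (i : Fin n) → X → K → Y i → ℝ) (x : Fin n → X) : ((i : Fin n) → Y i) → ℝ :=
  fun y => (∑ k : K, ∏ i, W i (x i) k (y i)) / (Fintype.card K)

/-- The product of `n` copies of a pmf is a pmf. -/
theorem IsPMF.pi {X : Type} [Fintype X] {n : ℕ} {μ : X → ℝ} (hμ : IsPMF μ) :
    IsPMF (fun x : Fin n → X => ∏ i, μ (x i)) := by
  refine ⟨fun x => Finset.prod_nonneg fun i _ => hμ.1 _, ?_⟩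
  have h := Finset.prod_univ_sum (fun _ : Fin n => (Finset.univ : Finset X)) (fun _ x => μ x)
  rw [Fintype.piFinset_univ] at h
  rw [← h]
  simp [hμ.2]

/-- The i.i.d. message distribution is the mixture of the fixed-input message distributions. -/
theorem keyedDist_eq_sum_messageDist {X K : Type} [Fintype X] [Fintype K] {n : ℕ}
    {Y : Fin n → Type} (W : (i : Fin n) → X → K → Y i → ℝ) (μ : X → ℝ)
    (y : (i : Fin n) → Y i) :
    keyedDist W μ y = ∑ x : Fin n → X, (∏ i, μ (x i)) * messageDist W x y := by
  have h (k : K) : ∏ i, ∑ x, μ x * W i x k (y i) =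
      ∑ x : Fin n → X, (∏ i, μ (x i)) * ∏ i, W i (x i) k (y i) := by
    rw [Finset.prod_univ_sum, Fintype.piFinset_univ]
    simp_rw [Finset.prod_mul_distrib]
  simp_rw [keyedDist, messageDist, h, ← mul_div_assoc, ← Finset.sum_div, Finset.mul_sum]
  rw [Finset.sum_comm]

theorem messageDist_nonneg {X K : Type} [Fintype K] {n : ℕ} {Y : Fin n → Type}
    [∀ i, Fintype (Y i)] {W : (i : Fin n) → X → K → Y i → ℝ} (hW : ∀ i, IsKeyedChannel (W i))
    (x : Fin n → X) (y : (i : Fin n) → Y i) : 0 ≤ messageDist W x y :=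
  div_nonneg (Finset.sum_nonneg fun k _ => Finset.prod_nonneg fun i _ => (hW i (x i) k).1 _)
    (Nat.cast_nonneg _)

/-- A set of messages that has probability `r` for every key has probability `r` on average. -/
theorem sum_messageDist_eq {X K : Type} [Fintype K] [Nonempty K] {n : ℕ} {Y : Fin n → Type}
    {W : (i : Fin n) → X → K → Y i → ℝ} {x : Fin n → X} {s : Finset ((i : Fin n) → Y i)} {r : ℝ}
    (h : ∀ k, ∑ y ∈ s, ∏ i, W i (x i) k (y i) = r) : ∑ y ∈ s, messageDist W x y = r := by
  have hK : (Fintype.card K : ℝ) ≠ 0 := Nat.cast_ne_zero.mpr Fintype.card_ne_zero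
  simp_rw [messageDist, ← Finset.sum_div]
  rw [Finset.sum_comm]
  simp [h, hK]

theorem isPMF_messageDist {X K : Type} [Fintype K] [Nonempty K] {n : ℕ} {Y : Fin n → Type}
    [∀ i, Fintype (Y i)] {W : (i : Fin n) → X → K → Y i → ℝ} (hW : ∀ i, IsKeyedChannel (W i))
    (x : Fin n → X) : IsPMF (messageDist W x) := by
  refine ⟨messageDist_nonneg hW x, sum_messageDist_eq fun k => ?_⟩
  have h := Finset.prod_univ_sum (fun i : Fin n => (Finset.univ : Finset (Y i)))
    (fun i y => W i (x i) k y)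
  rw [Fintype.piFinset_univ] at h
  rw [← h]
  exact Finset.prod_eq_one fun i _ => (hW i (x i) k).2

/-- If the conditional laws `D x` depend only on `f x`, then the distance between two mixtures of
them is at most the distance between the laws of `f`. -/
theorem tvDist_mixture_le {S T C : Type} [Fintype S] [Fintype T] [Fintype C] [DecidableEq C]
    (f : S → C) {D : S → T → ℝ} (hD : ∀ x, IsPMF (D x)) (hf : ∀ x x', f x = f x' → D x = D x')
    (p q : S → ℝ) :
    tvDist (fun y => ∑ x, p x * D x y) (fun y => ∑ x, q x * D x y) ≤
      tvDist (fun c => ∑ x with f x = c, p x) (fun c => ∑ x with f x = c, q x) := by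
  obtain ⟨Q, hQ0, hQ1, hQ⟩ : ∃ Q : C → T → ℝ, (∀ c y, 0 ≤ Q c y) ∧ (∀ c, ∑ y, Q c y ≤ 1) ∧
      ∀ x, D x = Q (f x) := by
    have h (c : C) : ∃ R : T → ℝ, (∀ y, 0 ≤ R y) ∧ ∑ y, R y ≤ 1 ∧ ∀ x, f x = c → D x = R := by
      by_cases hc : ∃ x, f x = c
      · obtain ⟨x₀, rfl⟩ := hc
        exact ⟨D x₀, (hD x₀).1, (hD x₀).2.le, fun x hx => hf x x₀ hx⟩
      · exact ⟨0, fun _ => le_rfl, by simp, fun x hx => absurd ⟨x, hx⟩ hc⟩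
    choose Q h0 h1 h2 using h
    exact ⟨Q, h0, h1, fun x => h2 _ x rfl⟩
  have hmix (r : S → ℝ) (y : T) :
      ∑ x, r x * D x y = ∑ c, (∑ x with f x = c, r x) * Q c y := by
    rw [← Finset.sum_fiberwise Finset.univ f]
    refine Finset.sum_congr rfl fun c _ => ?_
    rw [Finset.sum_mul]
    refine Finset.sum_congr rfl fun x hx => ?_
    rw [hQ, (Finset.mem_filter.mp hx).2]
  unfold tvDist
  simp_rw [hmix, ← Finset.sum_sub_distrib (f := fun c => _ * Q c _), ← sub_mul]
  gcongr
  calc ∑ y, |∑ c, ((∑ x with f x = c, p x) - ∑ x with f x = c, q x) * Q c y|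
      ≤ ∑ y, ∑ c, |(∑ x with f x = c, p x) - ∑ x with f x = c, q x| * Q c y := by
        refine Finset.sum_le_sum fun y _ => (Finset.abs_sum_le_sum_abs _ _).trans_eq ?_
        simp_rw [abs_mul, abs_of_nonneg (hQ0 _ _)]
    _ = ∑ c, |(∑ x with f x = c, p x) - ∑ x with f x = c, q x| * ∑ y, Q c y := by
        rw [Finset.sum_comm]
        simp_rw [Finset.mul_sum]
    _ ≤ _ := Finset.sum_le_sum fun c _ => mul_le_of_le_one_right (abs_nonneg _) (hQ1 c)

/-- Two pmfs on `Fin 2` that both give mass at least `1 - ε` to `b` are at distance at most `ε`. -/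
theorem tvDist_fin_two_le {P Q : Fin 2 → ℝ} (hP : IsPMF P) (hQ : IsPMF Q) {ε : ℝ} {b : Fin 2}
    (hPb : 1 - ε ≤ P b) (hQb : 1 - ε ≤ Q b) : tvDist P Q ≤ ε := by
  obtain ⟨hP0, hP1⟩ := hP
  obtain ⟨hQ0, hQ1⟩ := hQ
  rw [Fin.sum_univ_two] at hP1 hQ1
  have h₀ : |P 0 - Q 0| ≤ ε := by
    rw [abs_le]
    fin_cases b <;> simp at hPb hQb <;> constructor <;>
      linarith [hP0 0, hP0 1, hQ0 0, hQ0 1]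
  have h₁ : |P 1 - Q 1| = |P 0 - Q 0| := by
    rw [← abs_neg]
    congr 1
    linarith
  rw [tvDist, Fin.sum_univ_two, h₁]
  linarith

/-- The law of a function of a random variable is a pmf. -/
theorem IsPMF.fiber {S C : Type} [Fintype S] [Fintype C] [DecidableEq C] {p : S → ℝ}
    (hp : IsPMF p) (f : S → C) : IsPMF (fun c => ∑ x with f x = c, p x) :=
  ⟨fun _ => Finset.sum_nonneg fun x _ => hp.1 x, by rw [Finset.sum_fiberwise, hp.2]⟩

/-- applying a PSM protocol `({Wᵢ}, φ)` for a `(1−ε)`-correct hypothesis test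
`det : Xⁿ → {0,1}` for `H 0` vs. `H 1` yields an `(ε, ε)`-SDHT scheme for `H 0` vs. `H 1`
using `n` samples and a shared secret key uniform on `K`. -/
theorem stmt6 {X : Type} [Fintype X] {n : ℕ} (H : Fin 2 → Set (X → ℝ))
    (hH : ∀ b : Fin 2, ∀ μ ∈ H b, IsPMF μ) (ε : ℝ) (hε : 0 ≤ ε)
    -- `det` is a `(1−ε)`-correct hypothesis test for `H 0` vs. `H 1` using `n` samples:
    (det : (Fin n → X) → Fin 2)
    (hdet : ∀ b : Fin 2, ∀ μ ∈ H b,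
      1 - ε ≤ ∑ x ∈ Finset.univ.filter (fun x : Fin n → X => det x = b), ∏ i, μ (x i))
    -- `({Wᵢ}, φ)` is a PSM protocol for `det` with key set `K`:
    {K : Type} [Fintype K] [Nonempty K] {Y : Fin n → Type} [∀ i, Fintype (Y i)]
    (W : (i : Fin n) → X → K → Y i → ℝ) (hW : ∀ i, IsKeyedChannel (W i))
    (φ : ((i : Fin n) → Y i) → Fin 2)
    -- PSM correctness: for every input and key, the decoder outputs `det x` with prob. 1:
    (hcorrect : ∀ (x : Fin n → X) (k : K),
      ∑ y ∈ Finset.univ.filter (fun y : (i : Fin n) → Y i => φ y = det x),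
        ∏ i, W i (x i) k (y i) = 1)
    -- PSM privacy: inputs with the same value of `det` induce the same message distribution:
    (hpriv : ∀ x x' : Fin n → X, det x = det x' →
      (fun y : (i : Fin n) → Y i => (∑ k : K, ∏ i, W i (x i) k (y i)) / (Fintype.card K)) =
        (fun y : (i : Fin n) → Y i =>
          (∑ k : K, ∏ i, W i (x' i) k (y i)) / (Fintype.card K))) :
    IsKeyedSDHT W φ H ε ε := by
  refine ⟨fun b μ hμ => (hdet b μ hμ).trans ?_, fun b μ hμ μ' hμ' => ?_⟩
  · simp_rw [keyedDist_eq_sum_messageDist]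
    rw [Finset.sum_comm]
    simp_rw [← Finset.mul_sum]
    have hp := (hH b μ hμ).pi (n := n)
    calc ∑ x with det x = b, ∏ i, μ (x i)
        = ∑ x with det x = b, (∏ i, μ (x i)) * ∑ y with φ y = b, messageDist W x y := by
          refine Finset.sum_congr rfl fun x hx => ?_
          rw [← (Finset.mem_filter.mp hx).2, sum_messageDist_eq (hcorrect x), mul_one]
      _ ≤ _ := Finset.sum_le_sum_of_subset_of_nonneg (Finset.filter_subset _ _) fun x _ _ =>
          mul_nonneg (hp.1 x) (Finset.sum_nonneg fun y _ => messageDist_nonneg hW x y)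
  · have h := tvDist_mixture_le det (isPMF_messageDist hW) hpriv
      (fun x => ∏ i, μ (x i)) (fun x => ∏ i, μ' (x i))
    simp_rw [← keyedDist_eq_sum_messageDist] at h
    exact h.trans (tvDist_fin_two_le ((hH b μ hμ).pi.fiber det) ((hH b μ' hμ').pi.fiber det)
      (hdet b μ hμ) (hdet b μ' hμ'))
end

section
/- Let k > 1 be a real number. The function g defined on (0,1) by g(c) = (√k − c + √((1−c)(k−c))) / ((√k + √(k−c)) · (√k − 1)²) is non-increasing on (0,1). -/
/-- for a real `k > 1`, the function
`c ↦ (√k − c + √((1−c)(k−c))) / ((√k + √(k−c))·(√k − 1)²)` is non-increasing on `(0,1)`. -/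
theorem stmt8 (k : ℝ) (hk : 1 < k) :
    AntitoneOn
      (fun c : ℝ =>
        (Real.sqrt k - c + Real.sqrt ((1 - c) * (k - c))) /
          ((Real.sqrt k + Real.sqrt (k - c)) * (Real.sqrt k - 1) ^ 2))
      (Set.Ioo 0 1) := by
  rintro c ⟨-, hc⟩ d ⟨-, hd⟩ hcd
  have hs : 1 < √k := by rwa [Real.lt_sqrt zero_le_one, one_pow]
  have hq : √(k - d) ≤ √(k - c) := Real.sqrt_le_sqrt (by linarith)
  have hp : √(1 - d) ≤ √(1 - c) := Real.sqrt_le_sqrt (by linarith)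
  have hs2 : √k ^ 2 = k := Real.sq_sqrt (by linarith)
  have hqc : √(k - c) ^ 2 = k - c := Real.sq_sqrt (by linarith)
  have hqd : √(k - d) ^ 2 = k - d := Real.sq_sqrt (by linarith)
  have hqd0 := Real.sqrt_nonneg (k - d)
  have hpd0 := Real.sqrt_nonneg (1 - d)
  simp only [← div_div]
  rw [Real.sqrt_mul (by linarith), Real.sqrt_mul (by linarith)]
  refine div_le_div_of_nonneg_right ?_ (sq_nonneg _)
  generalize √k = s at *
  generalize √(k - c) = q₁ at *
  generalize √(k - d) = q₂ at *
  generalize √(1 - c) = p₁ at *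
  generalize √(1 - d) = p₂ at *
  obtain rfl : c = s ^ 2 - q₁ ^ 2 := by linarith
  obtain rfl : d = s ^ 2 - q₂ ^ 2 := by linarith
  rw [div_le_div_iff₀ (by linarith) (by linarith)]
  have hq₁ : 0 ≤ q₁ := hqd0.trans hq
  have hs0 : 0 ≤ s := by linarith
  have hss : 0 ≤ s * (s - 1) := mul_nonneg hs0 (by linarith)
  have h₁ : 0 ≤ (q₁ - q₂) * (s * (s - 1) + s * q₁ + s * q₂ + q₁ * q₂ + s * p₂) :=
    mul_nonneg (by linarith) (by positivity)
  have h₂ : 0 ≤ (p₁ - p₂) * (q₁ * (s + q₂)) := mul_nonneg (by linarith) (by positivity)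
  linarith
end

section
/- Let θ ∈ (0,1). For every c ∈ (0,1], (1 − √((1−c)(1−θc)) − c·√θ) / (1 − √(1−θc)) ≤ 1 + 2(1−√θ)/θ. (This is the ratio H²(Ber(1−c+(1−θ)c), Ber(1−c)) / H²(Ber(1), Ber(1−c+(1−θ)c)), i.e., the boundary case a + c = 1 of the Hellinger-ratio function.) -/
/-- for `θ ∈ (0,1)` and `c ∈ (0,1]`,
`(1 − √((1−c)(1−θc)) − c√θ) / (1 − √(1−θc)) ≤ 1 + 2(1−√θ)/θ`
(the boundary case `a + c = 1` of the Hellinger-ratio function). -/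
theorem stmt10 (θ : ℝ) (hθ : θ ∈ Set.Ioo (0:ℝ) 1) :
    ∀ c ∈ Set.Ioc (0:ℝ) 1,
      (1 - Real.sqrt ((1 - c) * (1 - θ * c)) - c * Real.sqrt θ) /
          (1 - Real.sqrt (1 - θ * c)) ≤
        1 + 2 * (1 - Real.sqrt θ) / θ := by
  obtain ⟨hθ0, hθ1⟩ := hθ
  rintro c ⟨hc0, hc1⟩
  have hprod : 0 < θ * c := mul_pos hθ0 hc0
  have hle : θ * c ≤ c := by nlinarith
  have hnum : 1 - c ≤ Real.sqrt ((1 - c) * (1 - θ * c)) :=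
    Real.le_sqrt_of_sq_le (by nlinarith)
  have hden : Real.sqrt (1 - θ * c) ≤ 1 - θ * c / 2 :=
    Real.sqrt_le_iff.mpr ⟨by linarith, by nlinarith [sq_nonneg (θ * c)]⟩
  have ht : Real.sqrt θ ≤ 1 := Real.sqrt_le_one.mpr hθ1.le
  have hcoef : 0 ≤ 2 * (1 - Real.sqrt θ) / θ := by
    have : 0 ≤ 1 - Real.sqrt θ := by linarith
    positivity
  have hmul : 2 * (1 - Real.sqrt θ) / θ * (θ * c / 2) = c * (1 - Real.sqrt θ) := by
    field_simp
  rw [div_le_iff₀ (by linarith)]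
  have hmono : 2 * (1 - Real.sqrt θ) / θ * (θ * c / 2) ≤
      2 * (1 - Real.sqrt θ) / θ * (1 - Real.sqrt (1 - θ * c)) :=
    mul_le_mul_of_nonneg_left (by linarith) hcoef
  linarith
end

section
/- Let θ ∈ (0,1), let c ∈ (0,1), and set c' = (1−θ)c. The function f defined on (0, 1−c) by f(a) = (1 − √(a(a+c')) − √((1−a)(1−a−c'))) / (1 − √((a+c')(a+c)) − √((1−a−c')(1−a−c))) is non-increasing on (0, 1−c); that is, for all 0 < a₁ ≤ a₂ < 1−c, f(a₂) ≤ f(a₁). -/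
/-- The squared Hellinger distance between the Bernoulli laws of parameters `a + u`, `a + v`. -/
noncomputable def hellingerShift (u v a : ℝ) : ℝ :=
  1 - √((a + u) * (a + v)) - √((1 - a - u) * (1 - a - v))

/-- The logarithmic derivative of `hellingerShift`, in terms of the two square roots. -/
noncomputable def hellingerLogDeriv (A C : ℝ) : ℝ :=
  (1 / C - 1 / A + A / C - C / A) / 2

theorem hellingerLogDeriv_mono {A₁ A₂ C₁ C₂ : ℝ} (hA₁ : 0 < A₁) (hC₂ : 0 < C₂)
    (hA : A₁ ≤ A₂) (hC : C₂ ≤ C₁) : hellingerLogDeriv A₁ C₁ ≤ hellingerLogDeriv A₂ C₂ := by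
  have hA₂ : 0 < A₂ := hA₁.trans_le hA
  have hC₁ : 0 < C₁ := hC₂.trans_le hC
  unfold hellingerLogDeriv
  gcongr

theorem hellingerShift_pos {u v a : ℝ} (huv : u < v) (hu : 0 < a + u) (hv : a + v < 1) :
    0 < hellingerShift u v a := by
  have hA : √((a + u) * (a + v)) < ((a + u) + (a + v)) / 2 := by
    rw [Real.sqrt_lt' (by linarith)]
    nlinarith [mul_pos (sub_pos.2 huv) (sub_pos.2 huv)]
  have hC : √((1 - a - u) * (1 - a - v)) < ((1 - a - u) + (1 - a - v)) / 2 := by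
    rw [Real.sqrt_lt' (by linarith)]
    nlinarith [mul_pos (sub_pos.2 huv) (sub_pos.2 huv)]
  unfold hellingerShift
  linarith

theorem hasDerivAt_hellingerShift {u v a : ℝ} (huv : u < v) (hu : 0 < a + u) (hv : a + v < 1) :
    HasDerivAt (hellingerShift u v)
      (hellingerShift u v a *
        hellingerLogDeriv √((a + u) * (a + v)) √((1 - a - u) * (1 - a - v))) a := by
  have hp : 0 < (a + u) * (a + v) := mul_pos hu (by linarith)
  have hq : 0 < (1 - a - u) * (1 - a - v) := mul_pos (by linarith) (by linarith)
  have hA := (((hasDerivAt_id a).add_const u).mul ((hasDerivAt_id a).add_const v)).sqrt hp.ne'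
  have hC := ((((hasDerivAt_id a).const_sub 1).sub_const u).mul
    (((hasDerivAt_id a).const_sub 1).sub_const v)).sqrt hq.ne'
  refine ((hA.const_sub 1).sub hC).congr_deriv ?_
  have hA2 := Real.sq_sqrt hp.le
  have hC2 := Real.sq_sqrt hq.le
  have hA0 := Real.sqrt_pos.2 hp
  have hC0 := Real.sqrt_pos.2 hq
  simp only [Pi.mul_apply, id_eq, hellingerShift, hellingerLogDeriv]
  generalize √((a + u) * (a + v)) = A at *
  generalize √((1 - a - u) * (1 - a - v)) = C at *
  have h₁ : 1 * (a + v) + (a + u) * 1 = 1 + A ^ 2 - C ^ 2 := by linarith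
  have h₂ : -1 * (1 - a - v) + (1 - a - u) * -1 = -(1 - A ^ 2 + C ^ 2) := by linarith
  rw [h₁, h₂]
  field_simp
  ring

theorem antitoneOn_hellingerShift_div {u v w : ℝ} (huv : u < v) (hvw : v < w) :
    AntitoneOn (fun a => hellingerShift u v a / hellingerShift v w a)
      (Set.Ioo (-u) (1 - w)) := by
  have hder : ∀ a ∈ Set.Ioo (-u) (1 - w),
      HasDerivAt (fun a => hellingerShift u v a / hellingerShift v w a) _ a := fun a ha =>
    (hasDerivAt_hellingerShift huv (by linarith [ha.1]) (by linarith [ha.2])).div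
      (hasDerivAt_hellingerShift hvw (by linarith [ha.1]) (by linarith [ha.2]))
      (hellingerShift_pos hvw (by linarith [ha.1]) (by linarith [ha.2])).ne'
  refine antitoneOn_of_hasDerivWithinAt_nonpos (convex_Ioo _ _)
    (fun a ha => (hder a ha).continuousAt.continuousWithinAt)
    (fun a ha => (hder a (interior_subset ha)).hasDerivWithinAt) fun a ha => ?_
  obtain ⟨ha₁, ha₂⟩ := interior_subset ha
  have hu : 0 < a + u := by linarith
  have hw : 0 < 1 - a - w := by linarith
  have hN := hellingerShift_pos huv hu (by linarith)
  have hD := hellingerShift_pos hvw (a := a) (by linarith) (by linarith)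
  have hK : hellingerLogDeriv √((a + u) * (a + v)) √((1 - a - u) * (1 - a - v)) ≤
      hellingerLogDeriv √((a + v) * (a + w)) √((1 - a - v) * (1 - a - w)) := by
    refine hellingerLogDeriv_mono (Real.sqrt_pos.2 (mul_pos hu (by linarith)))
      (Real.sqrt_pos.2 (mul_pos (by linarith) hw)) (Real.sqrt_le_sqrt ?_) (Real.sqrt_le_sqrt ?_)
    · nlinarith
    · nlinarith
  refine div_nonpos_of_nonpos_of_nonneg ?_ (sq_nonneg _)
  linarith [mul_le_mul_of_nonneg_left hK (mul_pos hN hD).le]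

/-- for `θ ∈ (0,1)`, `c ∈ (0,1)` and `c' = (1−θ)c`, the function
`a ↦ (1 − √(a(a+c')) − √((1−a)(1−a−c'))) / (1 − √((a+c')(a+c)) − √((1−a−c')(1−a−c)))`
is non-increasing on `(0, 1−c)`. -/
theorem stmt11 (θ c : ℝ) (hθ : θ ∈ Set.Ioo (0:ℝ) 1) (hc : c ∈ Set.Ioo (0:ℝ) 1) :
    AntitoneOn
      (fun a : ℝ =>
        (1 - Real.sqrt (a * (a + (1 - θ) * c)) -
            Real.sqrt ((1 - a) * (1 - a - (1 - θ) * c))) /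
          (1 - Real.sqrt ((a + (1 - θ) * c) * (a + c)) -
            Real.sqrt ((1 - a - (1 - θ) * c) * (1 - a - c))))
      (Set.Ioo 0 (1 - c)) := by
  have h := antitoneOn_hellingerShift_div (u := 0) (v := (1 - θ) * c) (w := c)
    (mul_pos (sub_pos.2 hθ.2) hc.1) (by nlinarith [mul_pos hθ.1 hc.1])
  simpa only [hellingerShift, add_zero, sub_zero, neg_zero] using h
end

section
/- Let q ∈ (0,1) be fixed. The function h_q defined on (0,1) by h_q(p) = (√(pq) − √((1−p)(1−q))) · (1 + √(pq) + √((1−p)(1−q))) / (2·√(pq(1−p)(1−q))) is non-decreasing in p on (0,1). -/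
/-- The quotient `(x - y)(1 + x + y) / (2xy)` increases when `x` grows and `y` shrinks. -/
theorem sub_mul_one_add_div_le {x y x' y' : ℝ} (hx : 0 < x) (hy' : 0 < y') (hxx : x ≤ x')
    (hyy : y' ≤ y) :
    (x - y) * (1 + x + y) / (2 * (x * y)) ≤ (x' - y') * (1 + x' + y') / (2 * (x' * y')) := by
  have hx' : 0 < x' := hx.trans_le hxx
  have hy : 0 < y := hy'.trans_le hyy
  have split : ∀ {u v : ℝ}, 0 < u → 0 < v →
      (u - v) * (1 + u + v) / (2 * (u * v)) = ((1 + u) / v - (1 + v) / u) / 2 := by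
    intro u v hu hv
    field_simp
    ring
  rw [split hx hy, split hx' hy']
  have h₁ : (1 + x) / y ≤ (1 + x') / y' := by gcongr
  have h₂ : (1 + y') / x' ≤ (1 + y) / x := by gcongr
  linarith

/-- for fixed `q ∈ (0,1)`, the function
`p ↦ (√(pq) − √((1−p)(1−q)))·(1 + √(pq) + √((1−p)(1−q))) / (2√(pq(1−p)(1−q)))`
is non-decreasing on `(0,1)`. -/
theorem stmt12 (q : ℝ) (hq : q ∈ Set.Ioo (0:ℝ) 1) :
    MonotoneOn
      (fun p : ℝ =>
        (Real.sqrt (p * q) - Real.sqrt ((1 - p) * (1 - q))) *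
            (1 + Real.sqrt (p * q) + Real.sqrt ((1 - p) * (1 - q))) /
          (2 * Real.sqrt (p * q * (1 - p) * (1 - q))))
      (Set.Ioo 0 1) := by
  obtain ⟨hq₀, hq₁⟩ := hq
  rintro p ⟨hp₀, hp₁⟩ r ⟨hr₀, hr₁⟩ hpr
  have sqrt_split : ∀ {t : ℝ}, 0 < t →
      √(t * q * (1 - t) * (1 - q)) = √(t * q) * √((1 - t) * (1 - q)) := by
    intro t ht
    rw [mul_assoc (t * q), Real.sqrt_mul (mul_pos ht hq₀).le]
  dsimp only
  rw [sqrt_split hp₀, sqrt_split hr₀]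
  have hq' : 0 < 1 - q := sub_pos.2 hq₁
  exact sub_mul_one_add_div_le (Real.sqrt_pos.2 (mul_pos hp₀ hq₀))
    (Real.sqrt_pos.2 (mul_pos (sub_pos.2 hr₁) hq')) (by gcongr) (by gcongr)
end

section
/- Let θ ∈ (0,1) and define K : (0,∞) → ℝ by K(t) = (1 − √(θ + (1−θ)t))² / (√t − √(θ + (1−θ)t))² for t ≠ 1, and K(1) = ((1−θ)/θ)². Then K is strictly increasing on (0,∞), and K(1) = lim_{t→1} K(t). -/
theorem ite_ratio_eq {θ t : ℝ} (hθ : θ ∈ Set.Ioo (0:ℝ) 1) (ht : 0 < t) :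
    (if t = 1 then ((1 - θ) / θ) ^ 2
      else (1 - Real.sqrt (θ + (1 - θ) * t)) ^ 2 /
        (Real.sqrt t - Real.sqrt (θ + (1 - θ) * t)) ^ 2) =
      ((1 - θ) / θ * ((Real.sqrt t + Real.sqrt (θ + (1 - θ) * t)) /
        (1 + Real.sqrt (θ + (1 - θ) * t)))) ^ 2 := by
  obtain ⟨h0, h1⟩ := hθ
  split_ifs with h
  · subst h
    norm_num
  · have hpos : 0 < θ + (1 - θ) * t := by nlinarith [mul_pos (sub_pos.2 h1) ht]
    have hr := Real.sq_sqrt ht.le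
    have hs := Real.sq_sqrt hpos.le
    have hr0 := Real.sqrt_pos.2 ht
    have hs0 := Real.sqrt_pos.2 hpos
    set r := Real.sqrt t
    set s := Real.sqrt (θ + (1 - θ) * t)
    have hrs : (r - s) * (r + s) = θ * (t - 1) := by linear_combination hr - hs
    have hne : r - s ≠ 0 := by
      intro h'
      rw [h', zero_mul] at hrs
      exact mul_ne_zero h0.ne' (sub_ne_zero.2 h) hrs.symm
    have hs1 : (1 - s) * (1 + s) = (1 - θ) * (1 - t) := by linear_combination -hs
    rw [← div_pow, ← neg_sq]
    congr 1
    have : 1 + s ≠ 0 := by positivity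
    field_simp
    linear_combination (-θ) * hs1 - (1 - θ) * hrs

theorem sqrt_add_div_one_add_lt {θ a b : ℝ} (hθ : θ ∈ Set.Ioo (0:ℝ) 1) (ha : 0 < a)
    (hab : a < b) :
    (Real.sqrt a + Real.sqrt (θ + (1 - θ) * a)) / (1 + Real.sqrt (θ + (1 - θ) * a)) <
      (Real.sqrt b + Real.sqrt (θ + (1 - θ) * b)) / (1 + Real.sqrt (θ + (1 - θ) * b)) := by
  obtain ⟨h0, h1⟩ := hθ
  have hr : Real.sqrt a < Real.sqrt b := Real.sqrt_lt_sqrt ha.le hab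
  have hlt : θ + (1 - θ) * a < θ + (1 - θ) * b := by nlinarith
  have hpos : 0 < θ + (1 - θ) * a := by nlinarith [mul_pos (sub_pos.2 h1) ha]
  have hs := Real.sqrt_lt_sqrt hpos.le hlt
  have hcross : Real.sqrt a * Real.sqrt (θ + (1 - θ) * b) <
      Real.sqrt b * Real.sqrt (θ + (1 - θ) * a) := by
    rw [← Real.sqrt_mul ha.le, ← Real.sqrt_mul (ha.trans hab).le]
    apply Real.sqrt_lt_sqrt
    · exact mul_nonneg ha.le (hpos.trans hlt).le
    · nlinarith
  rw [div_lt_div_iff₀ (by positivity) (by positivity)]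
  nlinarith

/-- for `θ ∈ (0,1)`, the function
`K(t) = (1 − √(θ+(1−θ)t))² / (√t − √(θ+(1−θ)t))²` for `t ≠ 1`, `K(1) = ((1−θ)/θ)²`,
is strictly increasing on `(0,∞)`, and `K(1)` is the limit of `K(t)` as `t → 1`. -/
theorem stmt14 (θ : ℝ) (hθ : θ ∈ Set.Ioo (0:ℝ) 1) :
    StrictMonoOn
      (fun t : ℝ =>
        if t = 1 then ((1 - θ) / θ) ^ 2
        else (1 - Real.sqrt (θ + (1 - θ) * t)) ^ 2 /
          (Real.sqrt t - Real.sqrt (θ + (1 - θ) * t)) ^ 2)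
      (Set.Ioi 0) ∧
    Filter.Tendsto
      (fun t : ℝ =>
        if t = 1 then ((1 - θ) / θ) ^ 2
        else (1 - Real.sqrt (θ + (1 - θ) * t)) ^ 2 /
          (Real.sqrt t - Real.sqrt (θ + (1 - θ) * t)) ^ 2)
      (nhdsWithin 1 {(1:ℝ)}ᶜ) (nhds (((1 - θ) / θ) ^ 2)) := by
  refine ⟨fun a ha b hb hab => ?_, ?_⟩
  · simp only [Set.mem_Ioi] at ha hb
    simp only [ite_ratio_eq hθ ha, ite_ratio_eq hθ hb]
    have hc : 0 < (1 - θ) / θ := div_pos (sub_pos.2 hθ.2) hθ.1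
    exact pow_lt_pow_left₀
      (mul_lt_mul_of_pos_left (sqrt_add_div_one_add_lt hθ ha hab) hc) (by positivity) two_ne_zero
  · have hcont : ContinuousAt (fun t : ℝ =>
        ((1 - θ) / θ * ((Real.sqrt t + Real.sqrt (θ + (1 - θ) * t)) /
          (1 + Real.sqrt (θ + (1 - θ) * t)))) ^ 2) 1 := by
      refine Continuous.continuousAt ?_
      have h : ∀ t : ℝ, 1 + Real.sqrt (θ + (1 - θ) * t) ≠ 0 := fun t => by positivity
      fun_prop (disch := assumption)
    have hlim := hcont.tendsto.mono_left (nhdsWithin_le_nhds (s := {(1:ℝ)}ᶜ))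
    rw [← ite_ratio_eq hθ one_pos, if_pos rfl] at hlim
    refine hlim.congr' ?_
    filter_upwards [nhdsWithin_le_nhds (Ioi_mem_nhds (zero_lt_one' ℝ))] with t ht
    exact (ite_ratio_eq hθ ht).symm
end

section
/- Let Y be a finite set, let i ≠ j be two elements of Y, let α₀ and α₁ be probability mass functions on Y satisfying α₀(i)·α₁(j) = α₀(j)·α₁(i), and let p, q ∈ [0,1]. Define P^{(1)} = (1−p)·α₀ + p·α₁ and P^{(2)} = (1−q)·α₀ + q·α₁, and let Y' be the set obtained from Y by merging i and j into a single symbol, with induced distributions P'^{(m)} given by P'^{(m)}(merged symbol) = P^{(m)}(i) + P^{(m)}(j) and P'^{(m)}(y) = P^{(m)}(y) for y ∉ {i,j}, m ∈ {1,2}. Then H²(P^{(1)}, P^{(2)}) = H²(P'^{(1)}, P'^{(2)}). -/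
/-- Equality case of the Cauchy–Schwarz inequality for square roots of proportional pairs. -/
theorem sqrt_add_mul_sqrt_add_of_mul_eq_mul {a b c d : ℝ} (ha : 0 ≤ a) (hb : 0 ≤ b) (hc : 0 ≤ c)
    (hd : 0 ≤ d) (h : a * d = b * c) :
    √(a + b) * √(c + d) = √a * √c + √b * √d := by
  have hcross : √a * √d = √b * √c := by
    rw [← Real.sqrt_mul ha, ← Real.sqrt_mul hb, h]
  rw [← Real.sqrt_mul (add_nonneg ha hb), Real.sqrt_eq_iff_mul_self_eq (by positivity)
    (by positivity)]
  symm
  calc (√a * √c + √b * √d) * (√a * √c + √b * √d)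
      = √a ^ 2 * √c ^ 2 + √b ^ 2 * √d ^ 2 + (√a * √d) * (√b * √c) + (√a * √d) * (√b * √c) := by
        ring
    _ = √a ^ 2 * √c ^ 2 + √b ^ 2 * √d ^ 2 + (√a * √d) ^ 2 + (√b * √c) ^ 2 := by
        rw [hcross]; ring
    _ = (a + b) * (c + d) := by
        simp only [mul_pow, Real.sq_sqrt ha, Real.sq_sqrt hb, Real.sq_sqrt hc, Real.sq_sqrt hd]
        ring

theorem sq_sqrt_sub_sqrt_add_of_mul_eq_mul {a b c d : ℝ} (ha : 0 ≤ a) (hb : 0 ≤ b) (hc : 0 ≤ c)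
    (hd : 0 ≤ d) (h : a * d = b * c) :
    (√a - √c) ^ 2 + (√b - √d) ^ 2 = (√(a + b) - √(c + d)) ^ 2 := by
  linear_combination Real.sq_sqrt ha + Real.sq_sqrt hb + Real.sq_sqrt hc + Real.sq_sqrt hd
    - Real.sq_sqrt (add_nonneg ha hb) - Real.sq_sqrt (add_nonneg hc hd)
    + 2 * sqrt_add_mul_sqrt_add_of_mul_eq_mul ha hb hc hd h

/-- merging two output symbols `i ≠ j` with equal likelihood ratios
(`α₀(i)·α₁(j) = α₀(j)·α₁(i)`) preserves the squared Hellinger distance between the mixtures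
`P⁽¹⁾ = (1−p)·α₀ + p·α₁` and `P⁽²⁾ = (1−q)·α₀ + q·α₁`: `H²` of the original distributions
equals the sum over the unmerged symbols plus the term for the merged supersymbol. -/
theorem stmt15 {Y : Type} [Fintype Y] [DecidableEq Y] (i j : Y) (hij : i ≠ j)
    (α0 α1 : Y → ℝ)
    (h0 : (∀ y, 0 ≤ α0 y) ∧ ∑ y, α0 y = 1) (h1 : (∀ y, 0 ≤ α1 y) ∧ ∑ y, α1 y = 1)
    (hratio : α0 i * α1 j = α0 j * α1 i)
    (p q : ℝ) (hp : p ∈ Set.Icc (0:ℝ) 1) (hq : q ∈ Set.Icc (0:ℝ) 1) :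
    hellingerSq (fun y => (1 - p) * α0 y + p * α1 y) (fun y => (1 - q) * α0 y + q * α1 y) =
      (∑ y ∈ (Finset.univ.erase i).erase j,
        (Real.sqrt ((1 - p) * α0 y + p * α1 y) -
          Real.sqrt ((1 - q) * α0 y + q * α1 y)) ^ 2) +
      (Real.sqrt (((1 - p) * α0 i + p * α1 i) + ((1 - p) * α0 j + p * α1 j)) -
        Real.sqrt (((1 - q) * α0 i + q * α1 i) + ((1 - q) * α0 j + q * α1 j))) ^ 2 := by
  have mix_nonneg : ∀ t ∈ Set.Icc (0 : ℝ) 1, ∀ y, 0 ≤ (1 - t) * α0 y + t * α1 y := fun t ht y =>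
    add_nonneg (mul_nonneg (sub_nonneg.2 ht.2) (h0.1 y)) (mul_nonneg ht.1 (h1.1 y))
  rw [← sq_sqrt_sub_sqrt_add_of_mul_eq_mul (mix_nonneg p hp i) (mix_nonneg p hp j)
    (mix_nonneg q hq i) (mix_nonneg q hq j) (by linear_combination (q - p) * hratio), hellingerSq,
    ← Finset.sum_erase_add _ _ (Finset.mem_univ i),
    ← Finset.sum_erase_add _ _ (Finset.mem_erase.2 ⟨hij.symm, Finset.mem_univ j⟩)]
  ring
end

section
/- Let k ≥ 2 be an integer, λ ∈ (0,1), and let (a₀^{(1)},…,a₀^{(k)}) and (a₂^{(1)},…,a₂^{(k)}) be probability vectors (nonnegative entries summing to 1). Define a₁^{(j)} = (1−λ)·a₀^{(j)} + λ·a₂^{(j)} for each j. Assume: (i) a₀^{(i)}·a₂^{(j)} ≤ a₀^{(j)}·a₂^{(i)} for all 1 ≤ i ≤ j ≤ k (monotone likelihood ratio ordering); (ii) a₀^{(1)} < a₂^{(1)}; (iii) a₀^{(2)} > 0 and a₀^{(1)}·a₂^{(2)} < a₀^{(2)}·a₂^{(1)}. Define H(x) = [ (√(a₂^{(1)}+x)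 − √(a₁^{(1)}+x))² + Σ_{j=2}^{k} (√(a₂^{(j)}) − √(a₁^{(j)}))² ] / [ (√(a₀^{(1)}+x) − √(a₁^{(1)}+x))² + Σ_{j=2}^{k} (√(a₀^{(j)}) − √(a₁^{(j)}))² ] for x ≥ 0. Then for all 0 ≤ x₁ < x₂ such that (a₀^{(1)}+x₂)·a₂^{(2)} ≤ a₀^{(2)}·(a₂^{(1)}+x₂), one has H(x₁) < H(x₂). -/
/-- The ratio `H(x)` of Lemma on the transformed channel: numerator and denominator are
squared Hellinger distances in which `x` is added to the first coordinate, where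
`a₁ = (1−λ)·a₀ + λ·a₂`. -/
noncomputable def Hratio (k : ℕ) (lam : ℝ) (a0 a2 : Fin (k + 2) → ℝ) (x : ℝ) : ℝ :=
  ((Real.sqrt (a2 0 + x) - Real.sqrt ((1 - lam) * a0 0 + lam * a2 0 + x)) ^ 2 +
      ∑ j ∈ Finset.univ.erase 0,
        (Real.sqrt (a2 j) - Real.sqrt ((1 - lam) * a0 j + lam * a2 j)) ^ 2) /
    ((Real.sqrt (a0 0 + x) - Real.sqrt ((1 - lam) * a0 0 + lam * a2 0 + x)) ^ 2 +
      ∑ j ∈ Finset.univ.erase 0,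
        (Real.sqrt (a0 j) - Real.sqrt ((1 - lam) * a0 j + lam * a2 j)) ^ 2)

/-- Cross-multiplied monotonicity of `(√a + √m) / (√b + √m)` in the likelihood ratio `b / a`,
where `m = (1 - l) * a + l * b`. -/
theorem sqrt_add_mul_sqrt_add_le {l a b c d : ℝ} (hl0 : 0 ≤ l) (hl1 : l ≤ 1) (ha : 0 ≤ a)
    (hb : 0 ≤ b) (hc : 0 ≤ c) (h : a * d ≤ c * b) :
    (√a + √((1 - l) * a + l * b)) * (√d + √((1 - l) * c + l * d)) + (√(c * b) - √(a * d)) ≤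
      (√c + √((1 - l) * c + l * d)) * (√b + √((1 - l) * a + l * b)) := by
  have hm : 0 ≤ (1 - l) * a + l * b :=
    add_nonneg (mul_nonneg (sub_nonneg.2 hl1) ha) (mul_nonneg hl0 hb)
  have h1 : √a * √((1 - l) * c + l * d) ≤ √c * √((1 - l) * a + l * b) := by
    rw [← Real.sqrt_mul ha, ← Real.sqrt_mul hc]
    exact Real.sqrt_le_sqrt (by nlinarith [mul_le_mul_of_nonneg_left h hl0])
  have h2 : √((1 - l) * a + l * b) * √d ≤ √b * √((1 - l) * c + l * d) := by
    rw [← Real.sqrt_mul hm, ← Real.sqrt_mul hb]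
    exact Real.sqrt_le_sqrt (by nlinarith [mul_le_mul_of_nonneg_left h (sub_nonneg.2 hl1)])
  rw [Real.sqrt_mul ha, Real.sqrt_mul hc]
  linarith

theorem sq_sqrt_sub_mul_sq_sqrt_add {x y : ℝ} (hx : 0 ≤ x) (hy : 0 ≤ y) :
    (√x - √y) ^ 2 * (√x + √y) ^ 2 = (x - y) ^ 2 := by
  rw [← mul_pow, mul_comm, ← sq_sub_sq, Real.sq_sqrt hx, Real.sq_sqrt hy]

/-- The products of squared Hellinger terms for two pairs `(a, b)` and `(c, d)`, cleared of
denominators. -/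
theorem hellinger_mul_eq {l a b c d : ℝ} (hl0 : 0 ≤ l) (hl1 : l ≤ 1) (ha : 0 ≤ a)
    (hb : 0 ≤ b) (hc : 0 ≤ c) (hd : 0 ≤ d) :
    ((√b - √((1 - l) * a + l * b)) ^ 2 * (√c - √((1 - l) * c + l * d)) ^ 2) *
      ((√c + √((1 - l) * c + l * d)) * (√b + √((1 - l) * a + l * b))) ^ 2 =
      ((1 - l) * l * (b - a) * (d - c)) ^ 2 := by
  have hm : 0 ≤ (1 - l) * a + l * b :=
    add_nonneg (mul_nonneg (sub_nonneg.2 hl1) ha) (mul_nonneg hl0 hb)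
  have hn : 0 ≤ (1 - l) * c + l * d :=
    add_nonneg (mul_nonneg (sub_nonneg.2 hl1) hc) (mul_nonneg hl0 hd)
  have h1 := sq_sqrt_sub_mul_sq_sqrt_add hb hm
  have h2 := sq_sqrt_sub_mul_sq_sqrt_add hc hn
  calc _ = ((√b - √((1 - l) * a + l * b)) ^ 2 * (√b + √((1 - l) * a + l * b)) ^ 2) *
        ((√c - √((1 - l) * c + l * d)) ^ 2 * (√c + √((1 - l) * c + l * d)) ^ 2) := by ring
    _ = _ := by rw [h1, h2]; ring

theorem hellinger_mul_eq' {l a b c d : ℝ} (hl0 : 0 ≤ l) (hl1 : l ≤ 1) (ha : 0 ≤ a)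
    (hb : 0 ≤ b) (hc : 0 ≤ c) (hd : 0 ≤ d) :
    ((√d - √((1 - l) * c + l * d)) ^ 2 * (√a - √((1 - l) * a + l * b)) ^ 2) *
      ((√a + √((1 - l) * a + l * b)) * (√d + √((1 - l) * c + l * d))) ^ 2 =
      ((1 - l) * l * (b - a) * (d - c)) ^ 2 := by
  rw [hellinger_mul_eq hl0 hl1 hc hd ha hb]
  ring

theorem hellinger_mul_le {l a b c d : ℝ} (hl : l ∈ Set.Ioo (0 : ℝ) 1) (ha : 0 ≤ a)
    (hb : 0 < b) (hc : 0 ≤ c) (hd : 0 ≤ d) (h : a * d ≤ c * b) :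
    (√b - √((1 - l) * a + l * b)) ^ 2 * (√c - √((1 - l) * c + l * d)) ^ 2 ≤
      (√d - √((1 - l) * c + l * d)) ^ 2 * (√a - √((1 - l) * a + l * b)) ^ 2 := by
  obtain ⟨hl0, hl1⟩ := hl
  have hl1' : 0 < 1 - l := sub_pos.2 hl1
  have hm : 0 < (1 - l) * a + l * b := by positivity
  have key := sqrt_add_mul_sqrt_add_le hl0.le hl1.le ha hb.le hc h
  have hs := Real.sqrt_le_sqrt h
  have e := hellinger_mul_eq hl0.le hl1.le ha hb.le hc hd
  rw [← hellinger_mul_eq' hl0.le hl1.le ha hb.le hc hd] at e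
  have hn : 0 ≤ (1 - l) * c + l * d := by positivity
  rcases hn.eq_or_lt with hn' | hn'
  · have hc0 : c = 0 := by nlinarith [mul_nonneg hl1'.le hc, mul_nonneg hl0.le hd]
    have hd0 : d = 0 := by nlinarith [mul_nonneg hl1'.le hc, mul_nonneg hl0.le hd]
    simp [hc0, hd0]
  · by_contra! hlt
    exact absurd e (ne_of_gt (mul_lt_mul hlt
      (pow_le_pow_left₀ (by positivity) (by linarith) 2) (by positivity) (by positivity)))

theorem hellinger_mul_lt {l a b c d : ℝ} (hl : l ∈ Set.Ioo (0 : ℝ) 1) (ha : 0 ≤ a)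
    (hab : a < b) (hc : 0 ≤ c) (hcd : c < d) (h : a * d < c * b) :
    (√b - √((1 - l) * a + l * b)) ^ 2 * (√c - √((1 - l) * c + l * d)) ^ 2 <
      (√d - √((1 - l) * c + l * d)) ^ 2 * (√a - √((1 - l) * a + l * b)) ^ 2 := by
  obtain ⟨hl0, hl1⟩ := hl
  have hl1' : 0 < 1 - l := sub_pos.2 hl1
  have hb : 0 < b := ha.trans_lt hab
  have hd : 0 < d := hc.trans_lt hcd
  have hm : 0 < (1 - l) * a + l * b := by positivity
  have hn : 0 < (1 - l) * c + l * d := by positivity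
  have e := hellinger_mul_eq hl0.le hl1.le ha hb.le hc hd.le
  have e' := hellinger_mul_eq' hl0.le hl1.le ha hb.le hc hd.le
  have key := sqrt_add_mul_sqrt_add_le hl0.le hl1.le ha hb.le hc h.le
  have hs := Real.sqrt_lt_sqrt (mul_nonneg ha hd.le) h
  have hab' := sub_pos.2 hab
  have hcd' := sub_pos.2 hcd
  have hK : 0 < ((1 - l) * l * (b - a) * (d - c)) ^ 2 := by positivity
  have hpos := pos_of_mul_pos_left (hK.trans_eq e.symm) (by positivity)
  rw [← e'] at e
  by_contra! hle
  exact absurd e (ne_of_gt (mul_lt_mul' hle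
    (pow_lt_pow_left₀ (by linarith) (by positivity) two_ne_zero) (by positivity) hpos))

theorem sq_sqrt_add_sub_sqrt_add_lt {u m x y : ℝ} (hu : 0 ≤ u) (hum : u < m) (hx : 0 ≤ x)
    (hxy : x < y) : (√(u + y) - √(m + y)) ^ 2 < (√(u + x) - √(m + x)) ^ 2 := by
  have e1 := sq_sqrt_sub_mul_sq_sqrt_add (add_nonneg hu hx) (add_nonneg (hu.trans hum.le) hx)
  have e2 := sq_sqrt_sub_mul_sq_sqrt_add (add_nonneg hu (hx.trans hxy.le))
    (add_nonneg (hu.trans hum.le) (hx.trans hxy.le))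
  have h1 : √(u + x) < √(u + y) := Real.sqrt_lt_sqrt (by positivity) (by linarith)
  have h2 : √(m + x) < √(m + y) := Real.sqrt_lt_sqrt (by linarith) (by linarith)
  have hK : 0 < (u - m) ^ 2 := by nlinarith
  rw [add_sub_add_right_eq_sub] at e1 e2
  have hpos : 0 < (√(u + y) - √(m + y)) ^ 2 :=
    pos_of_mul_pos_left (hK.trans_eq e2.symm) (by positivity)
  rw [← e1] at e2
  by_contra! hle
  refine absurd e2.symm (ne_of_lt (mul_lt_mul' hle ?_ (by positivity) hpos))
  gcongr

theorem add_div_add_lt_add_div_add {A₁ A₂ B₁ B₂ N D : ℝ} (hB₂ : 0 < B₂) (hB : B₂ < B₁)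
    (hD : 0 ≤ D) (hA : A₁ * B₂ < A₂ * B₁) (hN : A₂ * D ≤ N * B₂) :
    (A₁ + N) / (B₁ + D) < (A₂ + N) / (B₂ + D) := by
  rw [div_lt_div_iff₀ (by linarith) (by linarith)]
  have h : (A₁ - A₂) * D ≤ N * (B₁ - B₂) := by
    refine le_of_mul_le_mul_right ?_ hB₂
    nlinarith [mul_le_mul_of_nonneg_right hA.le hD,
      mul_le_mul_of_nonneg_right hN (sub_nonneg.2 hB.le)]
  nlinarith

/-- under the monotone likelihood ratio ordering and non-degeneracy conditions,
`H` is strictly increasing on the admissible range of `x`. -/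
theorem stmt16 (k : ℕ) (lam : ℝ) (hlam : lam ∈ Set.Ioo (0:ℝ) 1)
    (a0 a2 : Fin (k + 2) → ℝ)
    (h0nn : ∀ j, 0 ≤ a0 j) (h0sum : ∑ j, a0 j = 1)
    (h2nn : ∀ j, 0 ≤ a2 j) (h2sum : ∑ j, a2 j = 1)
    (hmlr : ∀ i j : Fin (k + 2), i ≤ j → a0 i * a2 j ≤ a0 j * a2 i)
    (hfirst : a0 0 < a2 0)
    (hsecond : 0 < a0 1) (hstrict : a0 0 * a2 1 < a0 1 * a2 0) :
    ∀ x1 x2 : ℝ, 0 ≤ x1 → x1 < x2 →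
      (a0 0 + x2) * a2 1 ≤ a0 1 * (a2 0 + x2) →
      Hratio k lam a0 a2 x1 < Hratio k lam a0 a2 x2 := by
  intro x1 x2 hx1 hx12 hadm
  obtain ⟨hl0, hl1⟩ := id hlam
  have hx2 : 0 < x2 := hx1.trans_lt hx12
  have hu : 0 ≤ a0 0 := h0nn 0
  have hum : a0 0 < (1 - lam) * a0 0 + lam * a2 0 := by nlinarith
  have hmix (x : ℝ) : (1 - lam) * a0 0 + lam * a2 0 + x =
      (1 - lam) * (a0 0 + x) + lam * (a2 0 + x) := by ring
  refine add_div_add_lt_add_div_add ?_ (sq_sqrt_add_sub_sqrt_add_lt hu hum hx1 hx12)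
    (Finset.sum_nonneg fun j _ => sq_nonneg _) ?_ ?_
  · exact sq_pos_of_neg (sub_neg.2 (Real.sqrt_lt_sqrt (by linarith) (by linarith)))
  · rw [hmix, hmix]
    exact hellinger_mul_lt hlam (by linarith) (by linarith) (by linarith) (by linarith)
      (by nlinarith)
  · rw [hmix, Finset.mul_sum, Finset.sum_mul]
    refine Finset.sum_le_sum fun j hj => ?_
    refine hellinger_mul_le hlam (by linarith) (by linarith) (h0nn j) (h2nn j) ?_
    have hj1 : 1 ≤ j := Fin.one_le_of_ne_zero (Finset.ne_of_mem_erase hj)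
    refine le_of_mul_le_mul_right ?_ hsecond
    nlinarith [mul_le_mul_of_nonneg_left (hmlr 1 j hj1) (add_nonneg hu hx2.le),
      mul_le_mul_of_nonneg_left hadm (h0nn j)]
end

section
/- Let X be a finite set and let μ₀, μ₁, μ₂ be probability mass functions on X such that the vectors μ₀ − μ₁ and μ₀ − μ₂ (viewed as vectors in ℝ^X) are linearly independent. Then there exists a function v : X → [0,1] such that Σ_{x∈X} v(x)·μ₀(x) = Σ_{x∈X} v(x)·μ₁(x) and Σ_{x∈X} v(x)·μ₀(x) ≠ Σ_{x∈X} v(x)·μ₂(x). Equivalently, there is a channel from X to {0,1} mapping μ₀ and μ₁ to the same Bernoulli distribution and mapping μ₂ to a different Bernoulli distribution. -/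
open Matrix

/-- If `a` and `b` are linearly independent, some vector is orthogonal to `a` but not to `b`. -/
theorem exists_dotProduct_eq_zero_and_ne_zero {X : Type*} [Fintype X] {a b : X → ℝ}
    (h : LinearIndependent ℝ ![a, b]) : ∃ w : X → ℝ, w ⬝ᵥ a = 0 ∧ w ⬝ᵥ b ≠ 0 := by
  have haa : a ⬝ᵥ a ≠ 0 := fun h' => h.ne_zero 0 (dotProduct_self_eq_zero.1 h')
  set w : X → ℝ := (-(a ⬝ᵥ b)) • a + (a ⬝ᵥ a) • b with hw
  have hwa : w ⬝ᵥ a = 0 := by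
    simp only [hw, add_dotProduct, smul_dotProduct, smul_eq_mul, dotProduct_comm b a]
    ring
  refine ⟨w, hwa, fun hwb => haa ?_⟩
  have hww : w ⬝ᵥ w = 0 := by
    nth_rewrite 2 [hw]
    simp [dotProduct_add, dotProduct_smul, hwa, hwb]
  exact (LinearIndependent.pair_iff.1 h _ _ (dotProduct_self_eq_zero.1 hww)).2

/-- A real function on a finite type can be scaled and recentred at `1 / 2` to be
`[0,1]`-valued. -/
theorem exists_pos_forall_half_add_mul_mem_Icc {X : Type*} [Fintype X] (w : X → ℝ) :
    ∃ c : ℝ, 0 < c ∧ ∀ x, 1 / 2 + c * w x ∈ Set.Icc (0 : ℝ) 1 := by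
  have hM : 0 < 2 * (1 + ‖w‖) := by positivity
  refine ⟨(2 * (1 + ‖w‖))⁻¹, inv_pos.2 hM, fun x => ?_⟩
  have hx : |w x| ≤ ‖w‖ := norm_le_pi_norm w x
  have hle : |(2 * (1 + ‖w‖))⁻¹ * w x| ≤ 1 / 2 := by
    rw [abs_mul, abs_of_pos (inv_pos.2 hM), inv_mul_le_iff₀ hM]
    linarith
  obtain ⟨hl, hr⟩ := abs_le.1 hle
  constructor <;> linarith

/-- if `μ₀ − μ₁` and `μ₀ − μ₂` are linearly independent in `ℝ^X`, there is a
`[0,1]`-valued function `v` on `X` (i.e. a channel to `{0,1}` with `W(1|x) = v(x)`) such that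
the channel maps `μ₀` and `μ₁` to the same Bernoulli distribution and maps `μ₂` to a
different one. -/
theorem stmt17 {X : Type} [Fintype X] (μ0 μ1 μ2 : X → ℝ)
    (h0 : (∀ x, 0 ≤ μ0 x) ∧ ∑ x, μ0 x = 1)
    (h1 : (∀ x, 0 ≤ μ1 x) ∧ ∑ x, μ1 x = 1)
    (h2 : (∀ x, 0 ≤ μ2 x) ∧ ∑ x, μ2 x = 1)
    (hind : LinearIndependent ℝ ![μ0 - μ1, μ0 - μ2]) :
    ∃ v : X → ℝ, (∀ x, v x ∈ Set.Icc (0:ℝ) 1) ∧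
      (∑ x, v x * μ0 x) = (∑ x, v x * μ1 x) ∧
      (∑ x, v x * μ0 x) ≠ (∑ x, v x * μ2 x) := by
  have ha : (μ0 - μ1) ⬝ᵥ 1 = 0 := by simp [dotProduct_one, h0.2, h1.2]
  have hb : (μ0 - μ2) ⬝ᵥ 1 = 0 := by simp [dotProduct_one, h0.2, h2.2]
  obtain ⟨w, hwa, hwb⟩ := exists_dotProduct_eq_zero_and_ne_zero hind
  obtain ⟨c, hc, hv⟩ := exists_pos_forall_half_add_mul_mem_Icc w
  have key (u : X → ℝ) (hu : (μ0 - u) ⬝ᵥ 1 = 0) :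
      ∑ x, (1 / 2 + c * w x) * μ0 x - ∑ x, (1 / 2 + c * w x) * u x = c * (w ⬝ᵥ (μ0 - u)) := by
    have expand : ∑ x, (1 / 2 + c * w x) * μ0 x - ∑ x, (1 / 2 + c * w x) * u x =
        1 / 2 * ((μ0 - u) ⬝ᵥ 1) + c * (w ⬝ᵥ (μ0 - u)) := by
      simp only [dotProduct, Finset.mul_sum, ← Finset.sum_sub_distrib, ← Finset.sum_add_distrib,
        Pi.sub_apply, Pi.one_apply]
      exact Finset.sum_congr rfl fun x _ => by ring
    rw [expand, hu, mul_zero, zero_add]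
  refine ⟨fun x => 1 / 2 + c * w x, hv, ?_, ?_⟩
  · rw [← sub_eq_zero, key μ1 ha, hwa, mul_zero]
  · rw [← sub_ne_zero, key μ2 hb]
    exact mul_ne_zero hc.ne' hwb
end
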